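/- Let Γ be a Coxeter graph with vertex set S. If for every free of infinity subset X ⊆ S the word problem in the virtual Artin group VA[Γ_X] is solvable, then the word problem in VA[Γ] is solvable. -/

import Mathlib

noncomputable instance (priority := 50) fintypePrimcodable {α : Type*} [Fintype α] [DecidableEq α] :
    Primcodable α :=
  Primcodable.ofEquiv (Fin (Fintype.card α)) (Fintype.equivFin α)

/-- The alternating product `a b a b ⋯` of length `m`. -/
def altProd {G : Type*} [Monoid G] (a b : G) (m : ℕ) : G :=
  ((List.range m).map (fun i => if i % 2 = 0 then a else b)).prod

/-- The restriction of a Coxeter matrix to a subset of its index set (the Coxeter matrix of the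
full Coxeter subgraph `Γ_X`). -/
def CoxeterMatrix.restrict {S : Type*} (M : CoxeterMatrix S) (X : Set S) : CoxeterMatrix X where
  M := fun x y => M x y
  isSymm := Matrix.IsSymm.ext fun x y => M.isSymm.apply x y
  diagonal := fun x => M.diagonal x
  off_diagonal := fun x y hxy => M.off_diagonal x y (fun h => hxy (Subtype.ext h))

/-- The defining relations of the virtual Artin group of a Coxeter matrix `M`.
The generator `Sum.inl s` plays the role of `σ_s` and `Sum.inr s` plays the role of `τ_s`.
The value `M s t = 0` encodes `m_{s,t} = ∞`. -/
def vaRels {S : Type*} (M : CoxeterMatrix S) : Set (FreeGroup (S ⊕ S)) :=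
  {r | ∃ s t : S, s ≠ t ∧ M s t ≠ 0 ∧
      r = altProd (FreeGroup.of (Sum.inl s)) (FreeGroup.of (Sum.inl t)) (M s t) *
        (altProd (FreeGroup.of (Sum.inl t)) (FreeGroup.of (Sum.inl s)) (M s t))⁻¹} ∪
  {r | ∃ s : S, r = FreeGroup.of (Sum.inr s) * FreeGroup.of (Sum.inr s)} ∪
  {r | ∃ s t : S, s ≠ t ∧ M s t ≠ 0 ∧
      r = altProd (FreeGroup.of (Sum.inr s)) (FreeGroup.of (Sum.inr t)) (M s t) *
        (altProd (FreeGroup.of (Sum.inr t)) (FreeGroup.of (Sum.inr s)) (M s t))⁻¹} ∪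
  {r | ∃ s t : S, s ≠ t ∧ M s t ≠ 0 ∧
      r = FreeGroup.of (Sum.inl s) *
          altProd (FreeGroup.of (Sum.inr t)) (FreeGroup.of (Sum.inr s)) (M s t - 1) *
        (altProd (FreeGroup.of (Sum.inr t)) (FreeGroup.of (Sum.inr s)) (M s t - 1) *
          FreeGroup.of (Sum.inl (if Even (M s t) then s else t)))⁻¹}

/-- The virtual Artin group `VA[Γ]` of a Coxeter matrix. -/
def VirtualArtinGroup {S : Type*} (M : CoxeterMatrix S) : Type _ :=
  PresentedGroup (vaRels M)

instance {S : Type*} (M : CoxeterMatrix S) : Group (VirtualArtinGroup M) := by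
  unfold VirtualArtinGroup; infer_instance

/-- The generator `σ_s` of the virtual Artin group. -/
def VirtualArtinGroup.sigma {S : Type*} (M : CoxeterMatrix S) (s : S) : VirtualArtinGroup M :=
  PresentedGroup.of (Sum.inl s)

/-- The generator `τ_s` of the virtual Artin group. -/
def VirtualArtinGroup.tau {S : Type*} (M : CoxeterMatrix S) (s : S) : VirtualArtinGroup M :=
  PresentedGroup.of (Sum.inr s)

/-- The standard parabolic subgroup `VA_X[Γ]` of the virtual Artin group, generated by
`{σ_x | x ∈ X} ∪ {τ_x | x ∈ X}`. -/
def VirtualArtinGroup.parabolic {S : Type*} (M : CoxeterMatrix S) (X : Set S) :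
    Subgroup (VirtualArtinGroup M) :=
  Subgroup.closure ((fun s => VirtualArtinGroup.sigma M s) '' X ∪
    (fun s => VirtualArtinGroup.tau M s) '' X)

/-- Evaluation in `G` of a word over an alphabet `A` of generators together with formal
inverses: the letter `(a, true)` is the generator `gen a` and `(a, false)` is its inverse. -/
def evalWord {A G : Type*} [Group G] (gen : A → G) (w : List (A × Bool)) : G :=
  (w.map fun p => if p.2 then gen p.1 else (gen p.1)⁻¹).prod

/-- A group `G` has a solvable word problem with respect to a generating family `gen : A → G`
if there is an algorithm deciding whether a word over `A ⊔ A⁻¹` represents the identity. -/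
def SolvableWordProblem {A G : Type*} [Primcodable A] [Group G] (gen : A → G) : Prop :=
  ComputablePred fun w : List (A × Bool) => evalWord gen w = 1

namespace CoxeterSystem

open List

section Exchange

variable {B W : Type*} [Group W] {M : CoxeterMatrix B} (cs : CoxeterSystem M W)

open Classical in
/-- The action of a simple reflection on the set `W × ℤ/2`: conjugation on the first factor,
flipping the sign of the reflection itself. -/
noncomputable def signPerm (i : B) : Equiv.Perm (W × ZMod 2) where
  toFun p := (cs.simple i * p.1 * cs.simple i, p.2 + if p.1 = cs.simple i then 1 else 0)
  invFun p := (cs.simple i * p.1 * cs.simple i, p.2 + if p.1 = cs.simple i then 1 else 0)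
  left_inv p := by
    have h : cs.simple i * p.1 * cs.simple i = cs.simple i ↔ p.1 = cs.simple i := by
      constructor
      · intro h
        simpa [mul_assoc] using congrArg (fun x => cs.simple i * x * cs.simple i) h
      · intro h; simp [h]
    ext
    · simp [mul_assoc]
    · simp only [h]
      split_ifs <;> simp [add_assoc, CharTwo.add_self_eq_zero]
  right_inv p := by
    have h : cs.simple i * p.1 * cs.simple i = cs.simple i ↔ p.1 = cs.simple i := by
      constructor
      · intro h
        simpa [mul_assoc] using congrArg (fun x => cs.simple i * x * cs.simple i) h
      · intro h; simp [h]
    ext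
    · simp [mul_assoc]
    · simp only [h]
      split_ifs <;> simp [add_assoc, CharTwo.add_self_eq_zero]

open Classical in
theorem signPerm_apply (i : B) (p : W × ZMod 2) :
    cs.signPerm i p =
      (cs.simple i * p.1 * cs.simple i, p.2 + if p.1 = cs.simple i then 1 else 0) := rfl

open Classical in
theorem signPerm_mul_pow_apply (i j : B) (k : ℕ) (p : W × ZMod 2) :
    ((cs.signPerm i * cs.signPerm j) ^ k) p =
      ((cs.simple i * cs.simple j) ^ k * p.1 * ((cs.simple i * cs.simple j) ^ k)⁻¹,
        p.2 + ∑ n ∈ Finset.range (2 * k),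
          if p.1 = cs.simple j * (cs.simple i * cs.simple j) ^ n then 1 else 0) := by
  induction k with
  | zero => simp
  | succ k ih =>
    rw [pow_succ', Equiv.Perm.mul_apply, ih, Equiv.Perm.mul_apply, signPerm_apply, signPerm_apply]
    set c := cs.simple i * cs.simple j with hc
    have hci : c⁻¹ = cs.simple j * cs.simple i := by simp [hc]
    have hjc : ∀ n : ℕ, (c ^ n)⁻¹ * cs.simple j = cs.simple j * c ^ n := by
      intro n
      induction n with
      | zero => simp
      | succ n ihn =>
        have h : c ^ n * c = cs.simple i * cs.simple j * c ^ n := by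
          rw [← hc, ← pow_succ, pow_succ']
        rw [pow_succ, mul_inv_rev, mul_assoc, ihn, hci, h]
        simp only [mul_assoc]
    have h1 : c ^ k * p.1 * (c ^ k)⁻¹ = cs.simple j ↔ p.1 = cs.simple j * c ^ (2 * k) := by
      rw [mul_inv_eq_iff_eq_mul, ← eq_inv_mul_iff_mul_eq, ← mul_assoc, hjc, mul_assoc, ← pow_add,
        two_mul]
    have h2 : cs.simple j * (c ^ k * p.1 * (c ^ k)⁻¹) * cs.simple j = cs.simple i ↔
        p.1 = cs.simple j * c ^ (2 * k + 1) := by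
      rw [← mul_assoc, ← mul_assoc]
      have e : cs.simple j * c ^ k * p.1 * (c ^ k)⁻¹ * cs.simple j = cs.simple i ↔
        c ^ k * p.1 * (c ^ k)⁻¹ = cs.simple j * c := by
        constructor
        · intro h
          have := congrArg (fun x => cs.simple j * x * cs.simple j) h
          simpa [mul_assoc, hc] using this
        · intro h
          have := congrArg (fun x => cs.simple j * x * cs.simple j) h
          simpa [mul_assoc, hc] using this
      rw [e, mul_inv_eq_iff_eq_mul, ← eq_inv_mul_iff_mul_eq, ← mul_assoc, ← mul_assoc, hjc,
        mul_assoc, mul_assoc, ← pow_succ', ← pow_add]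
      ring_nf
    ext
    · simp only [pow_succ', mul_inv_rev, hci]
      simp [mul_assoc, hc]
    · simp only [h1, h2]
      rw [show 2 * (k + 1) = 2 * k + 1 + 1 by ring, Finset.sum_range_succ, Finset.sum_range_succ]
      ring

theorem isLiftable_signPerm : M.IsLiftable cs.signPerm := by
  classical
  intro i j
  ext1 p
  rw [signPerm_mul_pow_apply]
  have h : (cs.simple i * cs.simple j) ^ M i j = 1 := cs.simple_mul_simple_pow i j
  rw [two_mul, Finset.sum_range_add]
  simp [pow_add, h, CharTwo.add_self_eq_zero]

/-- The sign cocycle of a Coxeter group. -/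
noncomputable def signHom : W →* Equiv.Perm (W × ZMod 2) := cs.lift ⟨_, cs.isLiftable_signPerm⟩

theorem signHom_simple (i : B) : cs.signHom (cs.simple i) = cs.signPerm i :=
  cs.lift_apply_simple cs.isLiftable_signPerm i

theorem signHom_apply (w t : W) (e : ZMod 2) :
    cs.signHom w (t, e) = (w * t * w⁻¹, e + (cs.signHom w (t, 0)).2) := by
  induction w using cs.simple_induction_left generalizing t e with
  | one => simp
  | mul_simple_left w i ih =>
    rw [map_mul, Equiv.Perm.mul_apply, Equiv.Perm.mul_apply, ih t e, ih t 0, signHom_simple,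
      signPerm_apply, signPerm_apply]
    ext
    · simp [mul_assoc]
    · simp [add_assoc]

theorem exists_eraseIdx_of_sign_ne_zero (ω : List B) (t : W)
    (h : (cs.signHom (cs.wordProd ω)⁻¹ (t, 0)).2 ≠ 0) :
    ∃ k < ω.length, t * cs.wordProd ω = cs.wordProd (ω.eraseIdx k) := by
  induction ω generalizing t with
  | nil => simp at h
  | cons a ω ih =>
    by_cases hta : t = cs.simple a
    · exact ⟨0, by simp, by simp [hta, wordProd_cons]⟩
    · rw [wordProd_cons, mul_inv_rev, inv_simple, map_mul, Equiv.Perm.mul_apply, signHom_simple,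
        signPerm_apply] at h
      simp only [hta, if_false, add_zero] at h
      obtain ⟨k, hk, hk'⟩ := ih _ h
      refine ⟨k + 1, by simpa using hk, ?_⟩
      rw [eraseIdx_cons_succ, wordProd_cons, wordProd_cons, ← hk']
      simp [mul_assoc]

/-- The exchange property. -/
theorem exchange (ω : List B) (i : B)
    (h : cs.length (cs.simple i * cs.wordProd ω) < cs.length (cs.wordProd ω)) :
    ∃ k < ω.length, cs.simple i * cs.wordProd ω = cs.wordProd (ω.eraseIdx k) := by
  classical
  apply cs.exists_eraseIdx_of_sign_ne_zero
  intro h0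
  set w := cs.wordProd ω
  obtain ⟨ω', hω', hw⟩ := cs.exists_isReduced (cs.simple i * w)
  have h1 : (cs.signHom (cs.wordProd ω')⁻¹ (cs.simple i, 0)).2 ≠ 0 := by
    rw [← hw, mul_inv_rev, inv_simple, map_mul, Equiv.Perm.mul_apply, signHom_simple,
      signPerm_apply]
    simp only [simple_mul_simple_self, one_mul, zero_add, if_true]
    rw [signHom_apply, h0]
    simp
  obtain ⟨k, hk, hk'⟩ := cs.exists_eraseIdx_of_sign_ne_zero ω' _ h1
  rw [← hw] at hk'
  simp only [simple_mul_simple_cancel_left] at hk'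
  have h2 := cs.length_wordProd_le (ω'.eraseIdx k)
  rw [← hk', length_eraseIdx_of_lt hk] at h2
  rw [hw, hω'.eq] at h
  omega

end Exchange

section Geometric

open Real Module

variable {B : Type*} (M : CoxeterMatrix B)

/-- The coroot of the geometric representation. -/
noncomputable def coroot (i : B) : Dual ℝ (B →₀ ℝ) :=
  Finsupp.linearCombination ℝ fun j => -2 * cos (π / M i j)

theorem coroot_single (i j : B) : coroot M i (Finsupp.single j 1) = -2 * cos (π / M i j) := by
  simp [coroot]

theorem coroot_self (i : B) : coroot M i (Finsupp.single i 1) = 2 := by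
  simp [coroot_single]

/-- The simple reflections of the geometric representation. -/
noncomputable def geomReflection (i : B) : (B →₀ ℝ) ≃ₗ[ℝ] (B →₀ ℝ) :=
  reflection (coroot_self M i)

theorem coroot_mul_coroot (i j : B) :
    coroot M i (Finsupp.single j 1) * coroot M j (Finsupp.single i 1) - 2 =
      2 * cos (2 * π / M i j) := by
  rw [coroot_single, coroot_single, M.symmetric j i, mul_div_assoc, cos_two_mul]
  ring

theorem sin_ne_zero_of_three_le {m : ℕ} (hm : 3 ≤ m) : sin (2 * π / m) ≠ 0 := by
  have h : (3 : ℝ) ≤ m := by exact_mod_cast hm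
  apply ne_of_gt
  apply sin_pos_of_pos_of_lt_pi
  · positivity
  · rw [div_lt_iff₀ (by linarith)]
    nlinarith [pi_pos]

theorem isLiftable_geomReflection : M.IsLiftable (geomReflection M) := by
  intro i j
  obtain rfl | hij := eq_or_ne i j
  · simp only [M.diagonal, pow_one]
    ext1 z
    simp [geomReflection, Module.involutive_reflection (coroot_self M i) z]
  by_cases h2 : M i j = 2
  · have hf : coroot M i (Finsupp.single j 1) = 0 := by simp [coroot_single, h2]
    have hg : coroot M j (Finsupp.single i 1) = 0 := by
      simp [coroot_single, M.symmetric j i, h2]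
    rw [h2]
    ext1 z
    simp only [geomReflection]
    rw [reflection_mul_reflection_pow_apply]
    norm_num [hf, hg]
    module
  have h1 : M i j ≠ 1 := M.off_diagonal i j hij
  rcases Nat.eq_zero_or_pos (M i j) with h0 | h0
  · rw [h0, pow_zero]
  have h3 : 3 ≤ M i j := by omega
  have hs := sin_ne_zero_of_three_le h3
  have hS : ∀ n : ℤ, (Polynomial.Chebyshev.S ℝ n).eval (2 * cos (2 * π / M i j)) =
      sin ((n + 1) * (2 * π / M i j)) / sin (2 * π / M i j) := fun n => by
    rw [eq_div_iff hs, Polynomial.Chebyshev.S_two_mul_real_cos]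
  have hM : (M i j : ℝ) ≠ 0 := by positivity
  ext1 z
  simp only [geomReflection]
  rw [reflection_mul_reflection_pow_apply _ _ _ _ _ (coroot_mul_coroot M i j).symm]
  rcases Nat.even_or_odd' (M i j) with ⟨k, hk | hk⟩
  · have e1 : ((M i j : ℤ) - 2) / 2 = k - 1 := by omega
    have e2 : ((M i j : ℤ) - 1) / 2 = k - 1 := by omega
    have hz : (Polynomial.Chebyshev.S ℝ (k - 1)).eval (2 * cos (2 * π / M i j)) = 0 := by
      rw [hS, div_eq_zero_iff]
      left
      have : ((((k : ℤ) - 1 : ℤ) : ℝ) + 1) * (2 * π / M i j) = π := by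
        have hk' : (M i j : ℝ) = 2 * k := by exact_mod_cast hk
        have : (k : ℝ) ≠ 0 := by rintro h; simp [hk', h] at hM
        rw [hk']; push_cast; field_simp; ring
      rw [this, sin_pi]
    rw [e1, e2, hz]
    simp
  · have e1 : ((M i j : ℤ) - 2) / 2 = k - 1 := by omega
    have e2 : ((M i j : ℤ) - 1) / 2 = k := by omega
    have e3 : ((M i j : ℤ)) / 2 = k := by omega
    have e4 : ((M i j : ℤ) - 3) / 2 = k - 1 := by omega
    have hz : (Polynomial.Chebyshev.S ℝ k).eval (2 * cos (2 * π / M i j)) +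
        (Polynomial.Chebyshev.S ℝ (k - 1)).eval (2 * cos (2 * π / M i j)) = 0 := by
      rw [hS, hS, ← add_div, div_eq_zero_iff]
      left
      have hk' : (M i j : ℝ) = 2 * k + 1 := by exact_mod_cast hk
      have : (((k : ℤ) : ℝ) + 1) * (2 * π / M i j) =
          2 * π - ((((k : ℤ) - 1 : ℤ) : ℝ) + 1) * (2 * π / M i j) := by
        have : (2 * k + 1 : ℝ) ≠ 0 := by positivity
        rw [hk']; push_cast; field_simp; ring
      rw [this, sin_two_pi_sub]
      ring
    rw [e1, e2, e3, e4, hz]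
    simp

variable {W : Type*} [Group W] {M} (cs : CoxeterSystem M W)

theorem simple_mul_simple_pow_ne_one {i j : B} (hij : i ≠ j) {k : ℕ} (hk : 0 < k)
    (hkM : k < M i j ∨ M i j = 0) : (cs.simple i * cs.simple j) ^ k ≠ 1 := by
  intro h
  have h' := congrArg (cs.lift ⟨_, isLiftable_geomReflection M⟩) h
  rw [map_pow, map_mul, lift_apply_simple, lift_apply_simple, map_one] at h'
  have hx := congrArg (fun e => e (Finsupp.single i (1 : ℝ))) h'
  simp only [geomReflection] at hx
  rw [reflection_mul_reflection_pow_apply_self _ _ _ _ (coroot_mul_coroot M i j).symm] at hx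
  have hi := DFunLike.congr_fun hx i
  have hj := DFunLike.congr_fun hx j
  simp [hij, hij.symm, coroot_single] at hi hj
  rw [M.symmetric j i] at hj
  have h1 : M i j ≠ 1 := M.off_diagonal i j hij
  rcases Nat.eq_zero_or_pos (M i j) with h0 | h0
  · simp [h0] at hi hj
    omega
  by_cases h2 : M i j = 2
  · obtain rfl : k = 1 := by omega
    norm_num [h2] at hi
  have h3 : 3 ≤ M i j := by omega
  have hs := sin_ne_zero_of_three_le h3
  have hS : ∀ n : ℤ, (Polynomial.Chebyshev.S ℝ n).eval (2 * cos (2 * π / M i j)) =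
      sin ((n + 1) * (2 * π / M i j)) / sin (2 * π / M i j) := fun n => by
    rw [eq_div_iff hs, Polynomial.Chebyshev.S_two_mul_real_cos]
  have hM : (3 : ℝ) ≤ M i j := by exact_mod_cast h3
  have hc : cos (π / M i j) ≠ 0 := by
    apply ne_of_gt
    apply cos_pos_of_mem_Ioo
    constructor
    · have : 0 < π / M i j := by positivity
      linarith [pi_pos]
    · rw [div_lt_div_iff₀ (by linarith) (by norm_num)]
      nlinarith [pi_pos]
  have hj' := hj.resolve_right hc
  rw [hj', add_zero, hS, div_eq_one_iff_eq hs] at hi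
  rw [hS, div_eq_zero_iff, or_iff_left hs] at hj'
  push_cast at hi hj'
  rw [sub_add_cancel] at hj'
  rw [add_mul, one_mul, sin_add, hj', zero_mul, zero_add, mul_eq_right₀ hs,
    cos_eq_one_iff] at hi
  obtain ⟨n, hn⟩ := hi
  have hn' : (n : ℝ) * M i j = k := by
    have := pi_pos
    field_simp at hn
    linarith
  have hn'' : n * (M i j : ℤ) = k := by exact_mod_cast hn'
  have hdvd : M i j ∣ k := by
    rw [← Int.natCast_dvd_natCast]
    exact ⟨n, by rw [← hn'', mul_comm]⟩
  have := Nat.le_of_dvd hk hdvd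
  omega

theorem orderOf_simple_mul_simple {i j : B} (hij : i ≠ j) :
    orderOf (cs.simple i * cs.simple j) = M i j := by
  rcases Nat.eq_zero_or_pos (M i j) with h0 | h0
  · rw [h0, orderOf_eq_zero_iff']
    exact fun n hn => cs.simple_mul_simple_pow_ne_one hij hn (Or.inr h0)
  · rw [orderOf_eq_iff h0]
    exact ⟨cs.simple_mul_simple_pow i j,
      fun k hk hk0 => cs.simple_mul_simple_pow_ne_one hij hk0 (Or.inl hk)⟩

theorem simple_injective : Function.Injective cs.simple := by
  intro i j h
  by_contra hij
  have h1 := cs.orderOf_simple_mul_simple hij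
  rw [h, simple_mul_simple_self, orderOf_one] at h1
  exact M.off_diagonal i j hij h1.symm

end Geometric

end CoxeterSystem

namespace CoxeterSystem

open List

variable {B W : Type*} [Group W] {M : CoxeterMatrix B} (cs : CoxeterSystem M W)

/-- The standard parabolic subgroup of a Coxeter group spanned by a set of simple reflections. -/
def parabolic (J : Set B) : Subgroup W := Subgroup.closure (cs.simple '' J)

theorem simple_mem_parabolic {J : Set B} {i : B} (hi : i ∈ J) : cs.simple i ∈ cs.parabolic J :=
  Subgroup.subset_closure ⟨i, hi, rfl⟩

theorem wordProd_mem_parabolic {J : Set B} {ω : List B} (hω : ∀ i ∈ ω, i ∈ J) :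
    cs.wordProd ω ∈ cs.parabolic J := by
  induction ω with
  | nil => simp [one_mem]
  | cons a ω ih =>
    rw [wordProd_cons]
    exact mul_mem (cs.simple_mem_parabolic (hω a (by simp))) (ih fun i hi => hω i (by simp [hi]))

theorem exists_word_of_mem_parabolic {J : Set B} {x : W} (hx : x ∈ cs.parabolic J) :
    ∃ ω : List B, (∀ i ∈ ω, i ∈ J) ∧ cs.wordProd ω = x := by
  induction hx using Subgroup.closure_induction with
  | mem x h =>
    obtain ⟨i, hi, rfl⟩ := h
    exact ⟨[i], by simpa using hi, by simp⟩
  | one => exact ⟨[], by simp, by simp⟩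
  | mul x y _ _ ihx ihy =>
    obtain ⟨a, ha, rfl⟩ := ihx
    obtain ⟨b, hb, rfl⟩ := ihy
    exact ⟨a ++ b, by simp only [mem_append]; rintro i (h | h); exacts [ha i h, hb i h],
      cs.wordProd_append a b⟩
  | inv x _ ih =>
    obtain ⟨a, ha, rfl⟩ := ih
    exact ⟨a.reverse, by simpa using ha, by simp⟩

/-- If `z` has minimal length in `W_J z`, then `ℓ (d z) = ℓ_J d + ℓ z` for `d ∈ W_J`. -/
theorem exists_word_length_mul_eq {J : Set B} {z : W}
    (hz : ∀ d ∈ cs.parabolic J, cs.length z ≤ cs.length (d * z)) {d : W}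
    (hd : d ∈ cs.parabolic J) :
    ∃ ω : List B, (∀ i ∈ ω, i ∈ J) ∧ cs.wordProd ω = d ∧
      cs.length (d * z) = ω.length + cs.length z := by
  classical
  suffices H : ∀ ω : List B, (∀ i ∈ ω, i ∈ J) →
      (∀ ω' : List B, (∀ i ∈ ω', i ∈ J) → cs.wordProd ω' = cs.wordProd ω →
        ω.length ≤ ω'.length) →
      cs.length (cs.wordProd ω * z) = ω.length + cs.length z by
    have hex : ∃ n, ∃ ω : List B, (∀ i ∈ ω, i ∈ J) ∧ cs.wordProd ω = d ∧ ω.length = n := by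
      obtain ⟨ω, h1, h2⟩ := cs.exists_word_of_mem_parabolic hd
      exact ⟨_, ω, h1, h2, rfl⟩
    obtain ⟨ω, h1, h2, h3⟩ := Nat.find_spec hex
    refine ⟨ω, h1, h2, ?_⟩
    rw [← h2]
    refine H ω h1 fun ω' h1' h2' => ?_
    rw [h3]
    exact Nat.find_min' hex ⟨ω', h1', h2'.trans h2, rfl⟩
  intro ω
  induction ω with
  | nil => simp
  | cons a ω ih =>
    intro hJ hmin
    have hJ' : ∀ i ∈ ω, i ∈ J := fun i hi => hJ i (mem_cons_of_mem _ hi)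
    have ha : a ∈ J := hJ a mem_cons_self
    have hω := ih hJ' fun ω' h1 h2 => by
      have := hmin (a :: ω') (by simpa [ha] using h1) (by rw [wordProd_cons, wordProd_cons, h2])
      simpa using this
    rw [wordProd_cons, mul_assoc]
    rcases cs.length_simple_mul (cs.wordProd ω * z) a with h | h
    · rw [h, hω, length_cons]; ring
    · exfalso
      obtain ⟨ωz, hωz, rfl⟩ := cs.exists_isReduced z
      obtain ⟨k, hk, hk'⟩ := cs.exchange (ω ++ ωz) a (by rw [wordProd_append]; omega)
      rw [wordProd_append] at hk'
      by_cases hkω : k < ω.length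
      · rw [eraseIdx_append_of_lt_length hkω, wordProd_append, ← mul_assoc] at hk'
        have := hmin (ω.eraseIdx k) (fun i hi => hJ' i (mem_of_mem_eraseIdx hi))
          (by rw [wordProd_cons]; exact (mul_right_cancel hk').symm)
        rw [length_eraseIdx_of_lt hkω, length_cons] at this
        omega
      · rw [eraseIdx_append_of_length_le (by omega), wordProd_append] at hk'
        rw [length_append] at hk
        have h1 := cs.length_wordProd_le (ωz.eraseIdx (k - ω.length))
        rw [length_eraseIdx_of_lt (by omega)] at h1
        have h2 := hz ((cs.wordProd ω)⁻¹ * cs.simple a * cs.wordProd ω)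
          (mul_mem (mul_mem (inv_mem (cs.wordProd_mem_parabolic hJ'))
            (cs.simple_mem_parabolic ha)) (cs.wordProd_mem_parabolic hJ'))
        have h3 : (cs.wordProd ω)⁻¹ * cs.simple a * cs.wordProd ω * cs.wordProd ωz =
            cs.wordProd (ωz.eraseIdx (k - ω.length)) := by
          rw [mul_assoc, mul_assoc, hk', inv_mul_cancel_left]
        rw [h3, hωz.eq] at h2
        omega

/-- `z` has minimal length in the coset `z W_J`. -/
def IsMinRep (J : Set B) (z : W) : Prop :=
  ∀ u ∈ cs.parabolic J, cs.length z ≤ cs.length (z * u)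

variable {cs}

theorem IsMinRep.exists_word {J : Set B} {z : W} (hz : cs.IsMinRep J z) {u : W}
    (hu : u ∈ cs.parabolic J) :
    ∃ ω : List B, (∀ i ∈ ω, i ∈ J) ∧ cs.wordProd ω = u ∧
      cs.length (z * u) = ω.length + cs.length z := by
  obtain ⟨ω, h1, h2, h3⟩ := cs.exists_word_length_mul_eq (J := J) (z := z⁻¹) (fun d hd => by
    have := hz d⁻¹ (inv_mem hd)
    rw [← cs.length_inv (d * z⁻¹), mul_inv_rev, inv_inv, length_inv]
    exact this) (inv_mem hu)
  refine ⟨ω.reverse, by simpa using h1, by simp [h2], ?_⟩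
  rw [← mul_inv_rev, length_inv, length_inv] at h3
  simpa using h3

theorem IsMinRep.eq_of_mul {J : Set B} {z u : W} (hz : cs.IsMinRep J z)
    (hu : u ∈ cs.parabolic J) (hzu : cs.IsMinRep J (z * u)) : u = 1 := by
  obtain ⟨ω, -, h2, h3⟩ := hz.exists_word hu
  have h4 := hzu u⁻¹ (inv_mem hu)
  rw [mul_inv_cancel_right] at h4
  have : ω = [] := List.length_eq_zero_iff.mp (by omega)
  rw [← h2, this, wordProd_nil]

theorem IsMinRep.exists_simple {J : Set B} {z u : W} (hz : cs.IsMinRep J z)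
    (hu : u ∈ cs.parabolic J) {i : B} (h : cs.simple i * z = z * u) :
    ∃ j ∈ J, u = cs.simple j := by
  obtain ⟨ω, h1, h2, h3⟩ := hz.exists_word hu
  rw [← h] at h3
  match ω, h1, h2, h3 with
  | [], _, _, h3 =>
    exact absurd (by simpa using h3) (cs.length_simple_mul_ne z i)
  | [j], h1, h2, _ => exact ⟨j, h1 j (by simp), by simpa using h2.symm⟩
  | _ :: _ :: _, _, _, h3 =>
    have := cs.length_simple_mul z i
    simp only [length_cons] at h3
    omega

theorem exists_isMinRep (J : Set B) (z : W) :
    ∃ u ∈ cs.parabolic J, cs.IsMinRep J (z * u) := by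
  classical
  have hex : ∃ n, ∃ u ∈ cs.parabolic J, cs.length (z * u) = n := ⟨_, 1, one_mem _, rfl⟩
  obtain ⟨u, hu, h⟩ := Nat.find_spec hex
  refine ⟨u, hu, fun v hv => ?_⟩
  rw [h, mul_assoc]
  exact Nat.find_min' hex ⟨_, mul_mem hu hv, rfl⟩

theorem IsMinRep.simple_mul {J : Set B} {z : W} (hz : cs.IsMinRep J z) {i : B}
    (h : z⁻¹ * (cs.simple i * z) ∉ cs.parabolic J) : cs.IsMinRep J (cs.simple i * z) := by
  obtain ⟨u, hu, hmin⟩ := exists_isMinRep (cs := cs) J (cs.simple i * z)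
  set z' := cs.simple i * z * u with hz'
  have e1 : cs.simple i * z = z' * u⁻¹ := by simp [hz']
  have e2 : cs.simple i * z' = z * u := by simp [hz', mul_assoc]
  obtain ⟨ω, h1, h2, h3⟩ := hz.exists_word hu
  obtain ⟨ω', h1', h2', h3'⟩ := hmin.exists_word (inv_mem hu)
  by_cases hu1 : u = 1
  · rwa [hz', hu1, mul_one] at hmin
  exfalso
  have hω : 0 < ω.length := by
    rw [Nat.pos_iff_ne_zero]; intro h0
    rw [List.length_eq_zero_iff.mp h0, wordProd_nil] at h2
    exact hu1 h2.symm
  have hω' : 0 < ω'.length := by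
    rw [Nat.pos_iff_ne_zero]; intro h0
    rw [List.length_eq_zero_iff.mp h0, wordProd_nil] at h2'
    exact hu1 (inv_eq_one.mp h2'.symm)
  rw [← e1] at h3'
  rw [← e2] at h3
  have l1 := cs.length_simple_mul z i
  have l2 := cs.length_simple_mul z' i
  obtain ⟨y, rfl⟩ : ∃ y, ω' = [y] := List.length_eq_one_iff.mp (by omega)
  simp only [wordProd_singleton] at h2'
  obtain ⟨ωz, hωz, hz''⟩ := cs.exists_isReduced z'
  have e3 : cs.wordProd (ωz ++ [y]) = cs.simple i * z := by
    rw [wordProd_append, wordProd_singleton, h2', ← hz'', e1]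
  obtain ⟨k, hk, hk'⟩ := cs.exchange (ωz ++ [y]) i (by
    rw [e3, simple_mul_simple_cancel_left]; omega)
  rw [e3, simple_mul_simple_cancel_left] at hk'
  rw [length_append, length_singleton] at hk
  have hl : cs.length z' = ωz.length := by rw [hz'', hωz.eq]
  by_cases hkω : k < ωz.length
  · rw [eraseIdx_append_of_lt_length hkω, wordProd_append, wordProd_singleton, h2'] at hk'
    have e4 : cs.simple i * z' = cs.wordProd (ωz.eraseIdx k) := by
      rw [e2, hk', inv_mul_cancel_right]
    have h5 := cs.length_wordProd_le (ωz.eraseIdx k)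
    rw [← e4, length_eraseIdx_of_lt hkω] at h5
    omega
  · rw [eraseIdx_append_of_length_le (by omega), show k - ωz.length = 0 by omega] at hk'
    simp only [eraseIdx_cons_zero, append_nil] at hk'
    rw [← hz''] at hk'
    apply h
    rw [e1, hk', inv_mul_cancel_left]
    exact inv_mem hu

theorem isMinRep_one (J : Set B) : cs.IsMinRep J 1 := fun u _ => by simp

end CoxeterSystem

namespace CoxeterSystem

open List

section CosetAction

variable {B W : Type*} [Group W] {M : CoxeterMatrix B} (cs : CoxeterSystem M W)

theorem exists_simple_of_mul_eq {K : Set B} {z f : W}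
    (hz : ∀ d ∈ cs.parabolic K, cs.length z ≤ cs.length (d * z)) (hf : f ∈ cs.parabolic K)
    {j : B} (h : f * z = z * cs.simple j) : ∃ a ∈ K, f = cs.simple a := by
  obtain ⟨ω, h1, h2, h3⟩ := cs.exists_word_length_mul_eq hz hf
  rw [h] at h3
  have h4 := cs.length_mul_simple z j
  obtain ⟨a, rfl⟩ : ∃ a, ω = [a] := List.length_eq_one_iff.mp (by omega)
  exact ⟨a, h1 a (by simp), by rw [← h2, wordProd_singleton]⟩

/-- The two alternating products of length `M i i'` agree. -/
theorem wordProd_alternatingWord_braid (i i' : B) :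
    cs.wordProd (alternatingWord i i' (M i i')) = cs.wordProd (alternatingWord i' i (M i i')) := by
  rw [cs.prod_alternatingWord_eq_prod_alternatingWord_sub i i' _ (by omega)]
  congr 2
  omega

theorem wordProd_alternatingWord_ne {i i' : B} (hne : i ≠ i') {k : ℕ} (hk : 0 < k)
    (hkM : k < M i i') :
    cs.wordProd (alternatingWord i i' k) ≠ cs.wordProd (alternatingWord i' i k) := by
  intro h
  refine cs.simple_mul_simple_pow_ne_one hne hk (Or.inl hkM) ?_
  have hinv : cs.simple i' * cs.simple i = (cs.simple i * cs.simple i')⁻¹ := by simp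
  rw [prod_alternatingWord_eq_mul_pow, prod_alternatingWord_eq_mul_pow, hinv] at h
  rcases Nat.even_or_odd' k with ⟨r, rfl | rfl⟩
  · simp only [even_two, Even.mul_right, if_true, one_mul, inv_pow] at h
    rw [Nat.mul_div_cancel_left _ two_pos, eq_inv_iff_mul_eq_one, ← pow_add] at h
    rw [two_mul, h]
  · have hodd : ¬ Even (2 * r + 1) := by simp
    rw [if_neg hodd, if_neg hodd, show (2 * r + 1) / 2 = r by omega, inv_pow,
      eq_mul_inv_iff_mul_eq] at h
    have h2 : cs.simple i * (cs.simple i' * (cs.simple i * cs.simple i') ^ r *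
        (cs.simple i * cs.simple i') ^ r) = 1 := by rw [h, simple_mul_simple_self]
    rw [mul_assoc, ← mul_assoc, ← pow_add, ← pow_succ', ← two_mul] at h2
    exact h2

variable {J : Set B} {G : Type*} [Group G]

open Classical in
/-- One step of the action on the pairs `(z, g)`: the simple reflection `i` either moves `z` or,
if it acts on the coset `z W_J` as the generator `j` acts on `W_J`, multiplies `g` by `κ j`. -/
noncomputable def step (κ : J → G) (i : B) (p : W × G) : W × G :=
  if h : ∃ j : J, cs.simple i * p.1 = p.1 * cs.simple j then (p.1, κ h.choose * p.2)
  else (cs.simple i * p.1, p.2)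

theorem step_of_eq (κ : J → G) {i : B} {z : W} {j : J}
    (h : cs.simple i * z = z * cs.simple j) (g : G) : cs.step κ i (z, g) = (z, κ j * g) := by
  have hex : ∃ j : J, cs.simple i * (z, g).1 = (z, g).1 * cs.simple j := ⟨j, h⟩
  have : hex.choose = j := by
    exact Subtype.ext (cs.simple_injective (mul_left_cancel (hex.choose_spec.symm.trans h)))
  rw [step, dif_pos hex, this]

theorem step_of_ne (κ : J → G) {i : B} {z : W}
    (h : ∀ j : J, cs.simple i * z ≠ z * cs.simple j) (g : G) :
    cs.step κ i (z, g) = (cs.simple i * z, g) :=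
  dif_neg fun ⟨j, hj⟩ => h j hj

theorem step_inv_step (κ : J → G) (i : B) (p : W × G) :
    cs.step κ⁻¹ i (cs.step κ i p) = p := by
  obtain ⟨z, g⟩ := p
  by_cases h : ∃ j : J, cs.simple i * z = z * cs.simple j
  · obtain ⟨j, hj⟩ := h
    rw [step_of_eq _ _ hj, step_of_eq _ _ hj, Pi.inv_apply, inv_mul_cancel_left]
  · rw [not_exists] at h
    rw [step_of_ne _ _ h, step_of_ne, simple_mul_simple_cancel_left]
    intro j hj
    apply h j
    rw [simple_mul_simple_cancel_left] at hj
    nth_rw 2 [hj]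
    rw [mul_assoc, simple_mul_simple_self, mul_one]

theorem isMinRep_simple_mul {z : W} (hz : cs.IsMinRep J z) {i : B}
    (h : ∀ j : J, cs.simple i * z ≠ z * cs.simple j) : cs.IsMinRep J (cs.simple i * z) := by
  refine hz.simple_mul fun hmem => ?_
  obtain ⟨j, hj, e⟩ := hz.exists_simple hmem (i := i) (by simp)
  exact h ⟨j, hj⟩ (by rw [← e, mul_inv_cancel_left])

theorem isMinRep_step (κ : J → G) (i : B) {p : W × G} (hp : cs.IsMinRep J p.1) :
    cs.IsMinRep J (cs.step κ i p).1 := by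
  obtain ⟨z, g⟩ := p
  by_cases h : ∃ j : J, cs.simple i * z = z * cs.simple j
  · obtain ⟨j, hj⟩ := h
    rwa [step_of_eq _ _ hj]
  · rw [not_exists] at h
    rw [step_of_ne _ _ h]
    exact cs.isMinRep_simple_mul hp h

/-- Iterated steps along the alternating sequence `i, i', i, …`. -/
noncomputable def run : B → B → List (J → G) → W × G → W × G
  | _, _, [], p => p
  | i, i', κ :: l, p => run i' i l (cs.step κ i p)

/-- Iterated left multiplications along the alternating sequence `j, j', j, …`. -/
def emit : J → J → List (J → G) → G → G
  | _, _, [], g => g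
  | j, j', κ :: l, g => emit j' j l (κ j * g)

theorem run_of_eq {i i' : B} {z : W} {j j' : J} (h : cs.simple i * z = z * cs.simple j)
    (h' : cs.simple i' * z = z * cs.simple j') (l : List (J → G)) (g : G) :
    cs.run i i' l (z, g) = (z, emit j j' l g) := by
  induction l generalizing i i' j j' g with
  | nil => rfl
  | cons κ l ih => rw [run, emit, cs.step_of_eq κ h, ih h' h]

theorem run_of_ne {i i' : B} {z : W}
    (h : ∀ d ∈ cs.parabolic {i, i'}, ∀ a ∈ ({i, i'} : Set B), ∀ j : J,
      cs.simple a * (d * z) ≠ d * z * cs.simple j) (l : List (J → G)) (g : G) :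
    cs.run i i' l (z, g) = (cs.wordProd (alternatingWord i' i l.length) * z, g) := by
  induction l generalizing i i' z g with
  | nil => simp [run, alternatingWord]
  | cons κ l ih =>
    rw [run, cs.step_of_ne κ (by simpa using h 1 (one_mem _) i (by simp)), ih, length_cons,
      alternatingWord_succ, wordProd_concat, mul_assoc]
    intro d hd a ha j
    rw [Set.pair_comm] at ha hd
    rw [← mul_assoc d]
    exact h _ (mul_mem hd (cs.simple_mem_parabolic (Or.inl rfl))) a ha j

section Path

variable {q : ℕ → W} {x : ℕ → B} {m : ℕ}

theorem run_up (hx : ∀ k, x (k + 2) = x k)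
    (hstep : ∀ k, k + 1 < m → cs.simple (x (k + 1)) * q k = q (k + 1))
    (hmove : ∀ k, k + 1 < m → ∀ j : J, cs.simple (x (k + 1)) * q k ≠ q k * cs.simple j)
    (l : List (J → G)) (k : ℕ) (hk : k + l.length < m) (g : G) :
    cs.run (x (k + 1)) (x k) l (q k, g) = (q (k + l.length), g) := by
  induction l generalizing k with
  | nil => rfl
  | cons κ l ih =>
    rw [length_cons] at hk ⊢
    rw [run, cs.step_of_ne κ (hmove k (by omega)), hstep k (by omega), ← hx k,
      ih (k + 1) (by omega)]
    congr 2
    omega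

theorem run_down (hx : ∀ k, x (k + 2) = x k)
    (hstep : ∀ k, k + 1 < m → cs.simple (x (k + 1)) * q k = q (k + 1))
    (hmove : ∀ k, k + 1 < m → ∀ j : J, cs.simple (x (k + 1)) * q k ≠ q k * cs.simple j)
    {y : J} (hy : cs.simple (x 0) * q 0 = q 0 * cs.simple y)
    (l : List (J → G)) (k : ℕ) (hk : k < m) (hkc : k < l.length) (hcm : l.length - k ≤ m) (g : G) :
    cs.run (x k) (x (k + 1)) l (q k, g) = (q (l.length - 1 - k), l[k] y * g) := by
  induction k generalizing l with
  | zero =>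
    obtain ⟨κ, l, rfl⟩ := List.exists_cons_of_length_pos hkc
    rw [length_cons] at hcm
    rw [run, cs.step_of_eq κ hy, zero_add, cs.run_up hx hstep hmove l 0 (by omega)]
    simp
  | succ k ih =>
    match l, hkc, hcm with
    | κ :: l, hkc, hcm =>
      rw [length_cons] at hkc hcm
      have hback : cs.simple (x (k + 1)) * q (k + 1) = q k := by
        rw [← hstep k hk, simple_mul_simple_cancel_left]
      rw [run, cs.step_of_ne κ, hback, show k + 1 + 1 = k + 2 from rfl, hx,
        ih l (by omega) (by omega) (by omega)]
      · simp only [length_cons, getElem_cons_succ]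
        congr 2
        omega
      · intro j hj
        apply hmove k hk j
        rw [hback] at hj
        rw [hstep k hk, hj, mul_assoc, simple_mul_simple_self, mul_one]

theorem run_path (hx : ∀ k, x (k + 2) = x k)
    (hstep : ∀ k, k + 1 < m → cs.simple (x (k + 1)) * q k = q (k + 1))
    (hmove : ∀ k, k + 1 < m → ∀ j : J, cs.simple (x (k + 1)) * q k ≠ q k * cs.simple j)
    {y : J} (hy : cs.simple (x 0) * q 0 = q 0 * cs.simple y)
    (hy' : cs.simple (x m) * q (m - 1) = q (m - 1) * cs.simple y)
    (l : List (J → G)) (hc : l.length = m) (k : ℕ) (hk : k < m) (g : G) :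
    cs.run (x k) (x (k + 1)) l (q k, g) = cs.run (x (k + 1)) (x k) l.reverse (q k, g) := by
  rw [cs.run_down hx hstep hmove hy l k hk (by omega) (by omega)]
  have hx2 : ∀ i k, x (k + 2 * i) = x k := by
    intro i
    induction i with
    | zero => simp
    | succ i ih => intro k; rw [mul_add, ← add_assoc, mul_one, hx, ih]
  have hback : ∀ k, k + 1 < m → cs.simple (x (k + 1)) * q (k + 1) = q k := fun k hk => by
    rw [← hstep k hk, simple_mul_simple_cancel_left]
  have e1 : ∀ k, k + 1 < m → x (m + (k + 1)) = x (m - 1 - (k + 1) + 1) := fun k hk => by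
    rw [← hx2 (k + 1) (m - 1 - (k + 1) + 1)]; congr 1; omega
  have e2 : ∀ k, k + 1 < m → m - 1 - k = m - 1 - (k + 1) + 1 := by omega
  have key := cs.run_down (q := fun k => q (m - 1 - k)) (x := fun k => x (m + k)) (m := m)
    (fun k => by rw [← add_assoc, hx])
    (fun k hk => by
      rw [e1 k hk, e2 k hk, hback _ (by omega)])
    (fun k hk j hj => by
      rw [e1 k hk, e2 k hk, hback _ (by omega), ← hstep _ (by omega)] at hj
      apply hmove _ (show m - 1 - (k + 1) + 1 < m by omega) j
      nth_rw 2 [hj]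
      rw [mul_assoc, simple_mul_simple_self, mul_one])
    hy' l.reverse (m - 1 - k) (by omega) (by simp; omega) (by simp; omega) g
  have e3 : x (m + (m - 1 - k)) = x (k + 1) := by
    rw [← hx2 (m - 1 - k) (k + 1)]; congr 1; omega
  have e4 : x (m + (m - 1 - k + 1)) = x k := by
    rw [← hx2 (m - k) k]; congr 1; omega
  simp only [e3, e4, length_reverse, hc, getElem_reverse] at key
  simp only [show m - 1 - (m - 1 - k) = k by omega] at key
  have e5 : l[l.length - 1 - (m - 1 - k)]'(by omega) = l[k] := by
    congr 1
    omega
  rw [key, e5, show l.length - 1 - k = m - 1 - k by rw [hc]]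

end Path

theorem exists_isMinRep_doubleCoset (K : Set B) (z : W) :
    ∃ z₀, ∃ d ∈ cs.parabolic K, ∃ u ∈ cs.parabolic J, z = d * z₀ * u ∧ cs.IsMinRep J z₀ ∧
      ∀ d ∈ cs.parabolic K, cs.length z₀ ≤ cs.length (d * z₀) := by
  classical
  have hex : ∃ n, ∃ z₀, ∃ d ∈ cs.parabolic K, ∃ u ∈ cs.parabolic J, z = d * z₀ * u ∧
      cs.length z₀ = n := ⟨_, z, 1, one_mem _, 1, one_mem _, by simp, rfl⟩
  obtain ⟨z₀, d, hd, u, hu, rfl, hn⟩ := Nat.find_spec hex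
  refine ⟨z₀, d, hd, u, hu, rfl, fun v hv => ?_, fun e he => ?_⟩
  · rw [hn]
    exact Nat.find_min' hex ⟨_, d, hd, v⁻¹ * u, mul_mem (inv_mem hv) hu, by simp [mul_assoc], rfl⟩
  · rw [hn]
    exact Nat.find_min' hex ⟨_, d * e⁻¹, mul_mem hd (inv_mem he), u, hu, by simp [mul_assoc], rfl⟩

theorem run_eq_run_of_eq_of_ne {i i' : B} (hne : i ≠ i') (hM : M i i' ≠ 0) {z₀ z : W}
    (hz₀ : cs.IsMinRep J z₀)
    (hmin : ∀ d ∈ cs.parabolic {i, i'}, cs.length z₀ ≤ cs.length (d * z₀))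
    {y : J} (hy : cs.simple i * z₀ = z₀ * cs.simple y)
    (hy' : ∀ j : J, cs.simple i' * z₀ ≠ z₀ * cs.simple j)
    (hz : cs.IsMinRep J z) {d u : W} (hd : d ∈ cs.parabolic {i, i'}) (hu : u ∈ cs.parabolic J)
    (hzd : z = d * z₀ * u) (l : List (J → G)) (hc : l.length = M i i') (g : G) :
    cs.run i i' l (z, g) = cs.run i' i l.reverse (z, g) := by
  set x : ℕ → B := fun k => if Even k then i else i' with hxdef
  set q : ℕ → W := fun k => cs.wordProd (alternatingWord i i' k) * z₀ with hq
  have hx : ∀ k, x (k + 2) = x k := fun k => by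
    simp only [hxdef, Nat.even_add, even_two, iff_true]
  have hxmem : ∀ k, x k ∈ ({i, i'} : Set B) := fun k => by
    simp only [hxdef]; split <;> simp
  have hx1 : ∀ k, x (k + 1) = if Even k then i' else i := fun k => by
    simp only [hxdef, Nat.even_add_one]; split <;> simp_all
  have halt : ∀ k, cs.wordProd (alternatingWord i i' (k + 1)) =
      cs.simple (x (k + 1)) * cs.wordProd (alternatingWord i i' k) := fun k => by
    rw [alternatingWord_succ', wordProd_cons, hx1]
  have halt' : ∀ k, cs.wordProd (alternatingWord i' i (k + 1)) =
      cs.wordProd (alternatingWord i i' k) * cs.simple i := fun k => by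
    rw [alternatingWord_succ, wordProd_concat]
  have haltmem : ∀ k, cs.wordProd (alternatingWord i i' k) ∈ cs.parabolic {i, i'} := by
    intro k
    induction k with
    | zero => simp [alternatingWord, one_mem]
    | succ k ih => rw [halt]; exact mul_mem (cs.simple_mem_parabolic (hxmem _)) ih
  have hstep : ∀ k, cs.simple (x (k + 1)) * q k = q (k + 1) := fun k => by
    simp only [hq]; rw [halt, mul_assoc]
  have hback : ∀ k, cs.simple (x (k + 1)) * q (k + 1) = q k := fun k => by
    rw [← hstep k, simple_mul_simple_cancel_left]
  have hmove : ∀ k, k + 1 < M i i' →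
      ∀ j : J, cs.simple (x (k + 1)) * q k ≠ q k * cs.simple j := by
    intro k hk j hj
    set e := cs.wordProd (alternatingWord i i' k) with he
    obtain ⟨a, ha, hf⟩ := cs.exists_simple_of_mul_eq hmin
      (f := e⁻¹ * cs.simple (x (k + 1)) * e)
      (mul_mem (mul_mem (inv_mem (haltmem k)) (cs.simple_mem_parabolic (hxmem _))) (haltmem k))
      (j := j) (by
        have hj' : cs.simple (x (k + 1)) * (e * z₀) = e * z₀ * cs.simple j := hj
        rw [mul_assoc, mul_assoc, hj', mul_assoc, inv_mul_cancel_left])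
    have hfz : cs.simple a * z₀ = z₀ * cs.simple j := by
      have hj' : cs.simple (x (k + 1)) * (e * z₀) = e * z₀ * cs.simple j := hj
      rw [← hf, mul_assoc, mul_assoc, hj', mul_assoc, inv_mul_cancel_left]
    rcases ha with rfl | rfl
    · refine cs.wordProd_alternatingWord_ne hne (Nat.succ_pos k) hk ?_
      rw [halt, halt', ← hf, mul_assoc, mul_inv_cancel_left]
    · exact hy' j hfz
  have hy₀ : cs.simple (x 0) * q 0 = q 0 * cs.simple y := by
    simpa [hxdef, hq, alternatingWord] using hy
  have hym : cs.simple (x (M i i')) * q (M i i' - 1) = q (M i i' - 1) * cs.simple y := by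
    obtain ⟨m, hm⟩ := Nat.exists_eq_succ_of_ne_zero hM
    have h1 := cs.wordProd_alternatingWord_braid i i'
    rw [hm, Nat.succ_eq_add_one, halt, halt'] at h1
    simp only [hm, hq, Nat.succ_eq_add_one, Nat.add_sub_cancel]
    rw [← mul_assoc, h1, mul_assoc, hy, mul_assoc]
  have hqmin : ∀ k, k < M i i' → cs.IsMinRep J (q k) := by
    intro k
    induction k with
    | zero => intro _; simpa [hq, alternatingWord] using hz₀
    | succ k ih =>
      intro hk
      rw [← hstep]
      exact cs.isMinRep_simple_mul (ih (by omega)) (hmove k hk)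
  have horbit : ∀ ω : List B, (∀ a ∈ ω, a ∈ ({i, i'} : Set B)) →
      ∃ k < M i i', ∃ v ∈ cs.parabolic J, cs.wordProd ω * z₀ = q k * v := by
    intro ω
    induction ω with
    | nil => exact fun _ => ⟨0, Nat.pos_of_ne_zero hM, 1, one_mem _, by simp [hq, alternatingWord]⟩
    | cons a ω ih =>
      intro hω
      obtain ⟨k, hk, v, hv, e⟩ := ih fun b hb => hω b (mem_cons_of_mem _ hb)
      rw [wordProd_cons, mul_assoc, e, ← mul_assoc]
      have ha : a = x k ∨ a = x (k + 1) := by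
        rw [hx1]; simp only [hxdef]
        rcases hω a mem_cons_self with rfl | rfl <;> split <;> simp
      have hyv : cs.simple y * v ∈ cs.parabolic J := mul_mem (cs.simple_mem_parabolic y.2) hv
      rcases ha with rfl | rfl
      · cases k with
        | zero => exact ⟨0, hk, _, hyv, by rw [hy₀, mul_assoc]⟩
        | succ k => exact ⟨k, by omega, v, hv, by rw [hback]⟩
      · by_cases hk1 : k + 1 < M i i'
        · exact ⟨k + 1, hk1, v, hv, by rw [hstep]⟩
        · obtain rfl : k = M i i' - 1 := by omega
          refine ⟨_, hk, _, hyv, ?_⟩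
          rw [Nat.sub_add_cancel (by omega), hym, mul_assoc]
  obtain ⟨k, hk, v, hv, e⟩ : ∃ k < M i i', ∃ v ∈ cs.parabolic J, d * z₀ = q k * v := by
    obtain ⟨ω, hω, rfl⟩ := cs.exists_word_of_mem_parabolic hd
    exact horbit ω hω
  have hzq : z = q k := by
    rw [e, mul_assoc] at hzd
    rw [hzd] at hz
    rw [hzd, (hqmin k hk).eq_of_mul (mul_mem hv hu) hz, mul_one]
  rw [hzq]
  have hpath := fun (l : List (J → G)) (hc : l.length = M i i') =>
    cs.run_path hx (fun k _ => hstep k) hmove hy₀ hym l hc k hk g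
  by_cases hek : Even k
  · have := hpath l hc
    rwa [show x (k + 1) = i' from (hx1 k).trans (if_pos hek),
      show x k = i from if_pos hek] at this
  · have := hpath l.reverse (by simpa using hc)
    simpa only [show x (k + 1) = i from (hx1 k).trans (if_neg hek),
      show x k = i' from if_neg hek, reverse_reverse] using this.symm

/-- The braid relation for the action on cosets: it holds as soon as it holds in `G`. -/
theorem run_eq_run_reverse {i i' : B} (hne : i ≠ i') (hM : M i i' ≠ 0) (l : List (J → G))
    (hc : l.length = M i i')
    (hG : ∀ j j' : J, j ≠ j' → M j j' = M i i' → ∀ g, emit j j' l g = emit j' j l.reverse g)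
    {z : W} (hz : cs.IsMinRep J z) (g : G) :
    cs.run i i' l (z, g) = cs.run i' i l.reverse (z, g) := by
  obtain ⟨z₀, d, hd, u, hu, hzd, hz₀, hmin⟩ := cs.exists_isMinRep_doubleCoset (J := J) {i, i'} z
  by_cases h : ∃ j : J, cs.simple i * z₀ = z₀ * cs.simple j
  · obtain ⟨y, hy⟩ := h
    by_cases h' : ∃ j : J, cs.simple i' * z₀ = z₀ * cs.simple j
    · obtain ⟨y', hy'⟩ := h'
      have horb : ∀ ω : List B, (∀ a ∈ ω, a ∈ ({i, i'} : Set B)) →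
          ∃ v ∈ cs.parabolic J, cs.wordProd ω * z₀ = z₀ * v := by
        intro ω
        induction ω with
        | nil => exact fun _ => ⟨1, one_mem _, by simp⟩
        | cons a ω ih =>
          intro hω
          obtain ⟨v, hv, e⟩ := ih fun b hb => hω b (mem_cons_of_mem _ hb)
          rw [wordProd_cons, mul_assoc, e, ← mul_assoc]
          rcases hω a mem_cons_self with rfl | rfl
          · exact ⟨_, mul_mem (cs.simple_mem_parabolic y.2) hv, by rw [hy, mul_assoc]⟩
          · exact ⟨_, mul_mem (cs.simple_mem_parabolic y'.2) hv, by rw [hy', mul_assoc]⟩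
      obtain ⟨ω, hω, rfl⟩ := cs.exists_word_of_mem_parabolic hd
      obtain ⟨v, hv, e⟩ := horb ω hω
      have hzz : z = z₀ := by
        rw [e, mul_assoc] at hzd
        rw [hzd] at hz
        rw [hzd, hz₀.eq_of_mul (mul_mem hv hu) hz, mul_one]
      have hyy : y ≠ y' := by
        rintro rfl
        rw [← hy'] at hy
        exact hne (cs.simple_injective (mul_right_cancel hy))
      have hMy : M y y' = M i i' := by
        rw [← cs.orderOf_simple_mul_simple hne,
          ← cs.orderOf_simple_mul_simple (Subtype.coe_injective.ne hyy)]
        have e1 : cs.simple y = z₀⁻¹ * cs.simple i * z₀ := by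
          rw [mul_assoc, hy, inv_mul_cancel_left]
        have e2 : cs.simple y' = z₀⁻¹ * cs.simple i' * z₀ := by
          rw [mul_assoc, hy', inv_mul_cancel_left]
        rw [e1, e2, show z₀⁻¹ * cs.simple i * z₀ * (z₀⁻¹ * cs.simple i' * z₀) =
          MulAut.conj z₀⁻¹ (cs.simple i * cs.simple i') by simp [mul_assoc]]
        exact MulEquiv.orderOf_eq _ _
      rw [hzz, cs.run_of_eq hy hy', cs.run_of_eq hy' hy, hG y y' hyy hMy]
    · rw [not_exists] at h'
      exact cs.run_eq_run_of_eq_of_ne hne hM hz₀ hmin hy h' hz hd hu hzd l hc g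
  · rw [not_exists] at h
    by_cases h' : ∃ j : J, cs.simple i' * z₀ = z₀ * cs.simple j
    · obtain ⟨y, hy⟩ := h'
      rw [Set.pair_comm] at hmin hd
      have hM' : M i' i = M i i' := M.symmetric i' i
      have := cs.run_eq_run_of_eq_of_ne hne.symm (hM' ▸ hM) hz₀ hmin hy h hz hd hu hzd l.reverse
        (by rw [length_reverse, hc, hM']) g
      rw [this, reverse_reverse]
    · rw [not_exists] at h'
      have hall : ∀ e ∈ cs.parabolic {i, i'}, ∀ a ∈ ({i, i'} : Set B), ∀ j : J,
          cs.simple a * (e * z₀) ≠ e * z₀ * cs.simple j := by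
        intro e he a ha j hj
        have hj' : e⁻¹ * cs.simple a * e * z₀ = z₀ * cs.simple j := by
          rw [mul_assoc, mul_assoc, hj, mul_assoc, inv_mul_cancel_left]
        obtain ⟨b, hb, hf⟩ := cs.exists_simple_of_mul_eq hmin
          (mul_mem (mul_mem (inv_mem he) (cs.simple_mem_parabolic ha)) he) hj'
        rw [hf] at hj'
        rcases hb with rfl | rfl
        exacts [h j hj', h' j hj']
      have hminall : ∀ ω : List B, (∀ a ∈ ω, a ∈ ({i, i'} : Set B)) →
          cs.IsMinRep J (cs.wordProd ω * z₀) := by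
        intro ω
        induction ω with
        | nil => simpa using hz₀
        | cons a ω ih =>
          intro hω
          have hω' : ∀ b ∈ ω, b ∈ ({i, i'} : Set B) := fun b hb => hω b (mem_cons_of_mem _ hb)
          rw [wordProd_cons, mul_assoc]
          exact cs.isMinRep_simple_mul (ih hω')
            (hall _ (cs.wordProd_mem_parabolic hω') a (hω a mem_cons_self))
      have hzz : z = d * z₀ := by
        obtain ⟨ω, hω, rfl⟩ := cs.exists_word_of_mem_parabolic hd
        rw [hzd] at hz
        rw [hzd, (hminall ω hω).eq_of_mul hu hz, mul_one]
      have hall' : ∀ e ∈ cs.parabolic {i, i'}, ∀ a ∈ ({i, i'} : Set B), ∀ j : J,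
          cs.simple a * (e * z) ≠ e * z * cs.simple j := fun e he a ha j => by
        rw [hzz, ← mul_assoc e]
        exact hall _ (mul_mem he hd) a ha j
      rw [cs.run_of_ne hall', cs.run_of_ne (by rw [Set.pair_comm]; exact hall'), length_reverse, hc,
        cs.wordProd_alternatingWord_braid]

end CosetAction

end CoxeterSystem

section AltProd

variable {H H' : Type*} [Group H] [Group H']

theorem altProd_succ (a b : H) (n : ℕ) :
    altProd a b (n + 1) = altProd a b n * if Even n then a else b := by
  simp [altProd, List.range_succ, Nat.even_iff]

theorem altProd_succ' (a b : H) (n : ℕ) : altProd a b (n + 1) = a * altProd b a n := by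
  induction n with
  | zero => simp [altProd]
  | succ n ih =>
    rw [altProd_succ, ih, altProd_succ, mul_assoc]
    simp only [Nat.even_add_one]
    split <;> simp_all

theorem map_altProd (f : H →* H') (a b : H) (n : ℕ) :
    f (altProd a b n) = altProd (f a) (f b) n := by
  simp only [altProd, map_list_prod, List.map_map]
  congr 1
  refine List.map_congr_left fun i _ => ?_
  simp only [Function.comp]
  split <;> rfl

/-- The product, read from right to left, of letters alternating between `i` and `i'` and having
the prescribed colours. -/
def altPath {I : Type*} (F : Bool → I → H) : I → I → List Bool → H
  | _, _, [] => 1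
  | i, i', c :: l => altPath F i' i l * F c i

variable {I : Type*} (F : Bool → I → H)

theorem altPath_append_singleton (i i' : I) (l : List Bool) (c : Bool) :
    altPath F i i' (l ++ [c]) = F c (if Even l.length then i else i') * altPath F i i' l := by
  induction l generalizing i i' with
  | nil => simp [altPath]
  | cons d l ih =>
    rw [List.cons_append, altPath, ih, altPath, mul_assoc, List.length_cons]
    simp only [Nat.even_add_one]
    split <;> simp_all

theorem altPath_replicate (i i' : I) (c : Bool) (n : ℕ) :
    altPath F i i' (List.replicate n c) =
      if Even n then altProd (F c i') (F c i) n else altProd (F c i) (F c i') n := by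
  induction n generalizing i i' with
  | zero => simp [altPath, altProd]
  | succ n ih =>
    rw [List.replicate_succ, altPath, ih]
    simp only [Nat.even_add_one]
    by_cases h : Even n <;> simp [h, altProd_succ]

theorem altPath_replicate_comm_iff (i i' : I) (c : Bool) (m : ℕ) :
    altPath F i i' (List.replicate m c) = altPath F i' i (List.replicate m c).reverse ↔
      altProd (F c i) (F c i') m = altProd (F c i') (F c i) m := by
  rw [List.reverse_replicate, altPath_replicate, altPath_replicate]
  split
  · exact eq_comm
  · rfl

theorem altPath_mixed_iff (i i' : I) {m : ℕ} (hm : m ≠ 0) :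
    altPath F i i' (true :: List.replicate (m - 1) false) =
        altPath F i' i (true :: List.replicate (m - 1) false).reverse ↔
      F true (if Even m then i else i') *
          altProd (F false (if Even m then i' else i)) (F false (if Even m then i else i'))
            (m - 1) =
        altProd (F false (if Even m then i' else i)) (F false (if Even m then i else i')) (m - 1) *
          F true i := by
  obtain ⟨m, rfl⟩ := Nat.exists_eq_succ_of_ne_zero hm
  simp only [Nat.succ_eq_add_one, Nat.add_sub_cancel, Nat.even_add_one, List.reverse_cons,
    List.reverse_replicate, altPath_append_singleton, altPath, altPath_replicate,
    List.length_replicate]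
  by_cases h : Even m <;> simp [h, eq_comm]

end AltProd

/-- A pair of families `F true`, `F false` of elements of a group that satisfies the defining
relations of the generators `σ`, `τ` of the virtual Artin group. -/
structure IsVirtualArtinRep {S H : Type*} [Group H] (M : CoxeterMatrix S) (F : Bool → S → H) :
    Prop where
  braid : ∀ c s t, s ≠ t → M s t ≠ 0 →
    altProd (F c s) (F c t) (M s t) = altProd (F c t) (F c s) (M s t)
  sq : ∀ s, F false s * F false s = 1
  mixed : ∀ s t, s ≠ t → M s t ≠ 0 →
    F true s * altProd (F false t) (F false s) (M s t - 1) =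
      altProd (F false t) (F false s) (M s t - 1) * F true (if Even (M s t) then s else t)

namespace IsVirtualArtinRep

variable {S H H' : Type*} [Group H] [Group H'] {M : CoxeterMatrix S} {F : Bool → S → H}

theorem comp (hF : IsVirtualArtinRep M F) (f : H →* H') :
    IsVirtualArtinRep M fun c s => f (F c s) where
  braid c s t hst hM := by rw [← map_altProd, ← map_altProd, hF.braid c s t hst hM]
  sq s := by rw [← map_mul, hF.sq, map_one]
  mixed s t hst hM := by
    rw [← map_altProd, ← map_mul, ← map_mul, hF.mixed s t hst hM]

/-- The colour patterns of the two sides of the defining relations of length `m`. -/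
def patterns (m : ℕ) : Set (List Bool) :=
  {List.replicate m true, List.replicate m false, true :: List.replicate (m - 1) false}

theorem length_of_mem_patterns {m : ℕ} (hm : m ≠ 0) {l : List Bool} (hl : l ∈ patterns m) :
    l.length = m := by
  rcases hl with rfl | rfl | rfl <;> simp
  omega

theorem altPath_eq (hF : IsVirtualArtinRep M F) {s t : S} (hst : s ≠ t) (hM : M s t ≠ 0)
    {l : List Bool} (hl : l ∈ patterns (M s t)) :
    altPath F s t l = altPath F t s l.reverse := by
  have hs : M t s = M s t := M.symmetric t s
  rcases hl with rfl | rfl | rfl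
  · exact (altPath_replicate_comm_iff F s t _ _).mpr (hF.braid _ s t hst hM)
  · exact (altPath_replicate_comm_iff F s t _ _).mpr (hF.braid _ s t hst hM)
  · rw [altPath_mixed_iff F s t hM]
    by_cases h : Even (M s t)
    · simpa [h] using hF.mixed s t hst hM
    · simpa [h, hs] using hF.mixed t s hst.symm (hs ▸ hM)

theorem of_altPath (hsq : ∀ s, F false s * F false s = 1)
    (h : ∀ s t, s ≠ t → M s t ≠ 0 → ∀ l ∈ patterns (M s t),
      altPath F s t l = altPath F t s l.reverse) : IsVirtualArtinRep M F where
  braid c s t hst hM := by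
    refine (altPath_replicate_comm_iff F s t _ _).mp (h s t hst hM _ ?_)
    cases c <;> simp [patterns]
  sq := hsq
  mixed s t hst hM := by
    have hs : M t s = M s t := M.symmetric t s
    by_cases hev : Even (M s t)
    · have := (altPath_mixed_iff F s t hM).mp (h s t hst hM _ (by simp [patterns]))
      simpa [hev] using this
    · have := (altPath_mixed_iff F t s (hs ▸ hM)).mp
        (h t s hst.symm (hs ▸ hM) _ (by simp [patterns]))
      simpa [hev, hs] using this

end IsVirtualArtinRep

namespace VirtualArtinGroup

section Presentation

variable {S : Type*} (M : CoxeterMatrix S) {H : Type*} [Group H]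

/-- The generator `σ_s` (colour `true`) or `τ_s` (colour `false`). -/
def gen (c : Bool) (s : S) : VirtualArtinGroup M := if c then sigma M s else tau M s

theorem mk_eq_one_of_mem {r : FreeGroup (S ⊕ S)} (hr : r ∈ vaRels M) :
    FreeGroup.lift (Sum.elim (sigma M) (tau M)) r = 1 := by
  have : FreeGroup.lift (Sum.elim (sigma M) (tau M)) = (PresentedGroup.mk (vaRels M) : _ →* _) := by
    ext x
    rcases x with s | s <;> simp <;> rfl
  rw [this]
  exact PresentedGroup.one_of_mem hr

theorem isRep_gen : IsVirtualArtinRep M (gen M) where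
  braid c s t hst hM := by
    cases c
    · have := mk_eq_one_of_mem M (Or.inl (Or.inr ⟨s, t, hst, hM, rfl⟩))
      simpa [map_altProd, mul_inv_eq_one, gen] using this
    · have := mk_eq_one_of_mem M (Or.inl (Or.inl (Or.inl ⟨s, t, hst, hM, rfl⟩)))
      simpa [map_altProd, mul_inv_eq_one, gen] using this
  sq s := by
    have := mk_eq_one_of_mem M (Or.inl (Or.inl (Or.inr ⟨s, rfl⟩)))
    simpa [gen] using this
  mixed s t hst hM := by
    have := mk_eq_one_of_mem M (Or.inr ⟨s, t, hst, hM, rfl⟩)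
    rw [map_mul, map_inv, mul_inv_eq_one] at this
    simpa [map_altProd, gen] using this

variable {M}

/-- The universal property of the virtual Artin group. -/
def lift {F : Bool → S → H} (hF : IsVirtualArtinRep M F) : VirtualArtinGroup M →* H :=
  PresentedGroup.toGroup (rels := vaRels M) (f := Sum.elim (F true) (F false)) (by
    rintro r (((⟨s, t, hst, hM, rfl⟩ | ⟨s, rfl⟩) | ⟨s, t, hst, hM, rfl⟩) | ⟨s, t, hst, hM, rfl⟩)
    · simpa [map_altProd, mul_inv_eq_one] using hF.braid true s t hst hM
    · simpa using hF.sq s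
    · simpa [map_altProd, mul_inv_eq_one] using hF.braid false s t hst hM
    · rw [map_mul, map_inv, mul_inv_eq_one]
      simpa [map_altProd] using hF.mixed s t hst hM)

@[simp]
theorem lift_gen {F : Bool → S → H} (hF : IsVirtualArtinRep M F) (c : Bool) (s : S) :
    lift hF (gen M c s) = F c s := by
  cases c <;> exact PresentedGroup.toGroup.of _

theorem closure_gen : Subgroup.closure (Set.range fun p : Bool × S => gen M p.1 p.2) = ⊤ := by
  refine eq_top_iff.mpr (le_trans (PresentedGroup.closure_range_of (vaRels M)).ge
    (Subgroup.closure_mono ?_))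
  rintro _ ⟨s | s, rfl⟩
  exacts [⟨(true, s), rfl⟩, ⟨(false, s), rfl⟩]

theorem hom_ext {f f' : VirtualArtinGroup M →* H} (h : ∀ c s, f (gen M c s) = f' (gen M c s)) :
    f = f' :=
  MonoidHom.eq_of_eqOn_dense closure_gen (by rintro _ ⟨p, rfl⟩; exact h _ _)

end Presentation

section Parabolic

variable {S : Type*} (M : CoxeterMatrix S)

theorem isRep_restrict {H : Type*} [Group H] {M : CoxeterMatrix S} {F : Bool → S → H}
    (hF : IsVirtualArtinRep M F) (X : Set S) :
    IsVirtualArtinRep (M.restrict X) fun c (s : X) => F c s where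
  braid c s t hst hM := hF.braid c s t (Subtype.coe_injective.ne hst) hM
  sq s := hF.sq s
  mixed s t hst hM := by
    have := hF.mixed s t (Subtype.coe_injective.ne hst) hM
    rwa [← apply_ite Subtype.val] at this

/-- The homomorphism from the virtual Artin group of a full subgraph. -/
def incl (X : Set S) : VirtualArtinGroup (M.restrict X) →* VirtualArtinGroup M :=
  lift (isRep_restrict (isRep_gen M) X)

@[simp]
theorem incl_gen (X : Set S) (c : Bool) (s : X) : incl M X (gen _ c s) = gen M c s :=
  lift_gen _ c s

theorem isRep_restrict_of_subset {X Y : Set S} (h : X ⊆ Y) :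
    IsVirtualArtinRep (M.restrict X) fun c s => gen (M.restrict Y) c (Set.inclusion h s) where
  braid c s t hst hM :=
    (isRep_gen (M.restrict Y)).braid c _ _ ((Set.inclusion_injective h).ne hst) hM
  sq s := (isRep_gen (M.restrict Y)).sq _
  mixed s t hst hM := by
    have := (isRep_gen (M.restrict Y)).mixed _ _ ((Set.inclusion_injective h).ne hst) hM
    rwa [← apply_ite (Set.inclusion h)] at this

/-- The homomorphism between the virtual Artin groups of nested full subgraphs. -/
def inclusion {X Y : Set S} (h : X ⊆ Y) :
    VirtualArtinGroup (M.restrict X) →* VirtualArtinGroup (M.restrict Y) :=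
  lift (isRep_restrict_of_subset M h)

@[simp]
theorem inclusion_gen {X Y : Set S} (h : X ⊆ Y) (c : Bool) (s : X) :
    inclusion M h (gen _ c s) = gen _ c (Set.inclusion h s) :=
  lift_gen _ c s

theorem incl_inclusion {X Y : Set S} (h : X ⊆ Y) (g : VirtualArtinGroup (M.restrict X)) :
    incl M Y (inclusion M h g) = incl M X g :=
  DFunLike.congr_fun (f := (incl M Y).comp (inclusion M h)) (hom_ext fun c s => by simp) g

end Parabolic

section CosetAction

variable {S : Type*} (M : CoxeterMatrix S) (J : Set S)

/-- The set on which the virtual Artin group acts: pairs of a minimal coset representative of the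
Coxeter group and an element of the virtual Artin group of the subgraph. -/
abbrev CosetSpace : Type _ :=
  {p : M.Group × VirtualArtinGroup (M.restrict J) // M.toCoxeterSystem.IsMinRep J p.1}

/-- The action of a generator on `CosetSpace M J`. -/
noncomputable def genPerm (c : Bool) (s : S) : Equiv.Perm (CosetSpace M J) where
  toFun p := ⟨M.toCoxeterSystem.step (gen (M.restrict J) c) s p.1,
    M.toCoxeterSystem.isMinRep_step _ s p.2⟩
  invFun p := ⟨M.toCoxeterSystem.step (gen (M.restrict J) c)⁻¹ s p.1,
    M.toCoxeterSystem.isMinRep_step _ s p.2⟩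
  left_inv p := Subtype.ext (M.toCoxeterSystem.step_inv_step _ s _)
  right_inv p := Subtype.ext (by
    simpa using M.toCoxeterSystem.step_inv_step (gen (M.restrict J) c)⁻¹ s p.1)

theorem altPath_genPerm (s t : S) (l : List Bool) (p : CosetSpace M J) :
    (altPath (genPerm M J) s t l p).1 =
      M.toCoxeterSystem.run s t (l.map (gen (M.restrict J))) p.1 := by
  induction l generalizing s t p with
  | nil => rfl
  | cons c l ih => rw [altPath, Equiv.Perm.mul_apply, ih]; rfl

theorem emit_gen (j j' : J) (l : List Bool) (g : VirtualArtinGroup (M.restrict J)) :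
    CoxeterSystem.emit j j' (l.map (gen (M.restrict J))) g =
      altPath (gen (M.restrict J)) j j' l * g := by
  induction l generalizing j j' g with
  | nil => simp [CoxeterSystem.emit, altPath]
  | cons c l ih => rw [List.map_cons, CoxeterSystem.emit, ih, altPath, mul_assoc]

theorem isRep_genPerm : IsVirtualArtinRep M (genPerm M J) := by
  refine IsVirtualArtinRep.of_altPath (fun s => ?_) fun s t hst hM l hl => ?_
  · have h : (gen (M.restrict J) false)⁻¹ = gen (M.restrict J) false := by
      ext j
      exact inv_eq_of_mul_eq_one_left ((isRep_gen _).sq j)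
    ext p : 2
    have := M.toCoxeterSystem.step_inv_step (gen (M.restrict J) false) s p.1
    rwa [h] at this
  · ext p : 2
    rw [altPath_genPerm, altPath_genPerm, List.map_reverse]
    refine M.toCoxeterSystem.run_eq_run_reverse hst hM _ ?_ (fun j j' hj hjM g => ?_) p.2 p.1.2
    · rw [List.length_map, IsVirtualArtinRep.length_of_mem_patterns hM hl]
    · rw [← List.map_reverse, emit_gen, emit_gen]
      congr 1
      have hjM' : M.restrict J j j' = M s t := hjM
      exact (isRep_gen (M.restrict J)).altPath_eq hj (hjM'.symm ▸ hM) (hjM'.symm ▸ hl)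

/-- The action of the virtual Artin group on `CosetSpace M J`. -/
noncomputable def cosetAction : VirtualArtinGroup M →* Equiv.Perm (CosetSpace M J) :=
  lift (isRep_genPerm M J)

/-- The base point of the action. -/
noncomputable def basePoint (g : VirtualArtinGroup (M.restrict J)) : CosetSpace M J :=
  ⟨(1, g), CoxeterSystem.isMinRep_one J⟩

theorem cosetAction_incl (x g : VirtualArtinGroup (M.restrict J)) :
    cosetAction M J (incl M J x) (basePoint M J g) = basePoint M J (x * g) := by
  have hx : x ∈ Subgroup.closure
      (Set.range fun p : Bool × J => gen (M.restrict J) p.1 p.2) := by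
    rw [closure_gen]; trivial
  induction hx using Subgroup.closure_induction generalizing g with
  | mem x h =>
    obtain ⟨⟨c, j⟩, rfl⟩ := h
    rw [incl_gen, cosetAction, lift_gen]
    exact Subtype.ext (M.toCoxeterSystem.step_of_eq _ (by simp) g)
  | one => simp
  | mul x y _ _ ihx ihy =>
    rw [map_mul, map_mul, Equiv.Perm.mul_apply, ihy, ihx, mul_assoc]
  | inv x _ ih => rw [map_inv, map_inv, Equiv.Perm.inv_eq_iff_eq, ih, mul_inv_cancel_left]

theorem incl_injective : Function.Injective (incl M J) := by
  intro x y h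
  have hx := cosetAction_incl M J x 1
  rw [h, cosetAction_incl] at hx
  simpa [basePoint] using (congrArg (fun p : CosetSpace M J => p.1.2) hx).symm

theorem inclusion_injective {X Y : Set S} (h : X ⊆ Y) : Function.Injective (inclusion M h) := by
  intro x y hxy
  apply incl_injective M X
  rw [← incl_inclusion M h, hxy, incl_inclusion]

/-- A set-theoretic retraction onto the virtual Artin group of a full subgraph. -/
noncomputable def retract (g : VirtualArtinGroup M) : VirtualArtinGroup (M.restrict J) :=
  (cosetAction M J g (basePoint M J 1)).1.2

theorem retract_incl (x : VirtualArtinGroup (M.restrict J)) : retract M J (incl M J x) = x := by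
  rw [retract, cosetAction_incl, mul_one]
  rfl

theorem mem_range_incl_iff {g : VirtualArtinGroup M} :
    g ∈ (incl M J).range ↔ incl M J (retract M J g) = g := by
  refine ⟨?_, fun h => ⟨_, h⟩⟩
  rintro ⟨x, rfl⟩
  rw [retract_incl]

end CosetAction

end VirtualArtinGroup

namespace VirtualArtinGroup

section Amalgam

variable {S : Type*} (M : CoxeterMatrix S) (X : Set S) (s t : S)

/-- The two factors of the amalgam splitting `VA[Γ_X]` along a pair with `m_{s,t} = ∞`. -/
def side (b : Bool) : Set S := {x ∈ X | x ≠ if b then s else t}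

/-- The amalgamated part of the splitting of `VA[Γ_X]` along a pair with `m_{s,t} = ∞`. -/
def core : Set S := {x ∈ X | x ≠ s ∧ x ≠ t}

theorem core_subset_side (b : Bool) : core X s t ⊆ side X s t b := fun x hx =>
  ⟨hx.1, by cases b; exacts [hx.2.2, hx.2.1]⟩

theorem side_subset (b : Bool) : side X s t b ⊆ X := fun _ hx => hx.1

/-- The inclusions of the amalgamated part in the factors. -/
def coreMap (b : Bool) : VirtualArtinGroup (M.restrict (core X s t)) →*
    VirtualArtinGroup (M.restrict (side X s t b)) :=
  inclusion M (core_subset_side X s t b)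

theorem exists_mem_side {s t : S} (hst : s ≠ t) {x y : X} (h : ¬ (x.1 = s ∧ y.1 = t))
    (h' : ¬ (x.1 = t ∧ y.1 = s)) : ∃ b, x.1 ∈ side X s t b ∧ y.1 ∈ side X s t b := by
  by_cases hs : x.1 = s ∨ y.1 = s
  · refine ⟨false, ⟨x.2, ?_⟩, y.2, ?_⟩ <;> simp only [Bool.false_eq_true, if_false] <;>
      rintro h1 <;> rcases hs with h2 | h2 <;> simp_all
  · rw [not_or] at hs
    exact ⟨true, ⟨x.2, hs.1⟩, y.2, hs.2⟩

open Classical in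
/-- The images of the generators in the amalgamated product. -/
noncomputable def amalgamGen (c : Bool) (x : X) : Monoid.PushoutI (coreMap M X s t) :=
  if h : x.1 ∈ side X s t true then
    Monoid.PushoutI.of (G := fun b => VirtualArtinGroup (M.restrict (side X s t b))) true
      (gen _ c ⟨x, h⟩)
  else if h : x.1 ∈ side X s t false then
    Monoid.PushoutI.of (G := fun b => VirtualArtinGroup (M.restrict (side X s t b))) false
      (gen _ c ⟨x, h⟩)
  else 1

variable {s t}

theorem amalgamGen_eq (b c : Bool) (x : X) (h : x.1 ∈ side X s t b) :
    amalgamGen M X s t c x =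
      Monoid.PushoutI.of (G := fun b => VirtualArtinGroup (M.restrict (side X s t b))) b
        (gen _ c ⟨x, h⟩) := by
  cases b
  · by_cases h' : x.1 ∈ side X s t true
    · have hx : x.1 ∈ core X s t := ⟨x.2, h'.2, h.2⟩
      have e : ∀ b, coreMap M X s t b (gen _ c ⟨x, hx⟩) =
          gen _ c ⟨x, core_subset_side X s t b hx⟩ := fun b => inclusion_gen M _ c ⟨x, hx⟩
      rw [amalgamGen, dif_pos h', ← e true, ← e false, Monoid.PushoutI.of_apply_eq_base,
        Monoid.PushoutI.of_apply_eq_base]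
    · rw [amalgamGen, dif_neg h', dif_pos h]
  · rw [amalgamGen, dif_pos h]

theorem isRep_amalgamGen (hst : s ≠ t) (hM : M s t = 0) :
    IsVirtualArtinRep (M.restrict X) (amalgamGen M X s t) := by
  have hside : ∀ x y : X, M.restrict X x y ≠ 0 →
      ∃ b, x.1 ∈ side X s t b ∧ y.1 ∈ side X s t b := by
    intro x y hxy
    refine exists_mem_side X hst ?_ ?_
    · rintro ⟨h1, h2⟩
      exact hxy (show M x y = 0 by rw [h1, h2, hM])
    · rintro ⟨h1, h2⟩
      exact hxy (show M x y = 0 by rw [h1, h2, M.symmetric, hM])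
  have hrep := fun b => (isRep_gen (M.restrict (side X s t b))).comp
    (Monoid.PushoutI.of (φ := coreMap M X s t) b)
  refine ⟨fun c x y hxy hm => ?_, fun x => ?_, fun x y hxy hm => ?_⟩
  · obtain ⟨b, hx, hy⟩ := hside x y hm
    rw [amalgamGen_eq M X b c x hx, amalgamGen_eq M X b c y hy]
    exact (hrep b).braid c ⟨x, hx⟩ ⟨y, hy⟩ (fun h => hxy (Subtype.ext (Subtype.mk.inj h))) hm
  · obtain ⟨b, hx, -⟩ := hside x x (by rw [(M.restrict X).diagonal]; exact one_ne_zero)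
    rw [amalgamGen_eq M X b _ x hx]
    exact (hrep b).sq ⟨x, hx⟩
  · obtain ⟨b, hx, hy⟩ := hside x y hm
    have := (hrep b).mixed ⟨x, hx⟩ ⟨y, hy⟩ (fun h => hxy (Subtype.ext (Subtype.mk.inj h))) hm
    rw [apply_ite (amalgamGen M X s t true)]
    simp only [amalgamGen_eq M X b _ x hx, amalgamGen_eq M X b _ y hy]
    rw [apply_ite (fun z => Monoid.PushoutI.of (φ := coreMap M X s t) b (gen _ true z))] at this
    exact this

/-- The homomorphism from `VA[Γ_X]` to the amalgamated product. -/
noncomputable def toAmalgam (hst : s ≠ t) (hM : M s t = 0) :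
    VirtualArtinGroup (M.restrict X) →* Monoid.PushoutI (coreMap M X s t) :=
  lift (isRep_amalgamGen M X hst hM)

theorem toAmalgam_inclusion_side (hst : s ≠ t) (hM : M s t = 0) (b : Bool)
    (g : VirtualArtinGroup (M.restrict (side X s t b))) :
    toAmalgam M X hst hM (inclusion M (side_subset X s t b) g) =
      Monoid.PushoutI.of (G := fun b => VirtualArtinGroup (M.restrict (side X s t b))) b g :=
  DFunLike.congr_fun (f := (toAmalgam M X hst hM).comp (inclusion M (side_subset X s t b)))
    (g := Monoid.PushoutI.of (φ := coreMap M X s t) b) (hom_ext fun c x => by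
      rw [MonoidHom.comp_apply, inclusion_gen, toAmalgam, lift_gen,
        amalgamGen_eq M X b c _ x.2]) g

/-- An alternating product of elements of the two factors that are outside of the amalgamated part
is outside of the amalgamated part. -/
theorem prod_notMem_range_incl_core (hst : s ≠ t) (hM : M s t = 0)
    (L : List (Bool × VirtualArtinGroup M)) (hchain : L.IsChain fun p q => p.1 ≠ q.1)
    (hside : ∀ p ∈ L, p.2 ∈ (incl M (side X s t p.1)).range)
    (hcore : ∀ p ∈ L, p.2 ∉ (incl M (core X s t)).range) (hne : L ≠ []) :
    (L.map Prod.snd).prod ∉ (incl M (core X s t)).range := by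
  let f : (Σ b, VirtualArtinGroup (M.restrict (side X s t b))) → Bool × VirtualArtinGroup M :=
    fun p => (p.1, incl M _ p.2)
  obtain ⟨K, rfl⟩ : L ∈ Set.range (List.map f) := by
    rw [Set.range_list_map]
    intro p hp
    obtain ⟨g, hg⟩ := hside p hp
    exact ⟨⟨p.1, g⟩, Prod.ext rfl hg⟩
  have hK : ∀ p ∈ K, p.2 ∉ (coreMap M X s t p.1).range := by
    rintro p hp ⟨g, hg⟩
    refine hcore (f p) (List.mem_map_of_mem hp) ⟨g, ?_⟩
    rw [← incl_inclusion M (core_subset_side X s t p.1)]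
    exact congrArg _ hg
  let w : Monoid.CoprodI.Word fun b => VirtualArtinGroup (M.restrict (side X s t b)) :=
    { toList := K
      ne_one := fun p hp h1 => hK p hp (by rw [h1]; exact one_mem _)
      chain_ne := (List.isChain_map f).mp hchain }
  rintro ⟨g, hg⟩
  have hprod : ((K.map f).map Prod.snd).prod = incl M X
      ((K.map fun p => inclusion M (side_subset X s t p.1) p.2).prod) := by
    rw [map_list_prod, List.map_map, List.map_map]
    congr 1
    refine List.map_congr_left fun p _ => ?_
    exact (incl_inclusion M (side_subset X s t p.1) p.2).symm
  have hcX : core X s t ⊆ X := fun _ hx => hx.1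
  rw [hprod, ← incl_inclusion M hcX] at hg
  have hg' := congrArg (toAmalgam M X hst hM) (incl_injective M X hg)
  have hbase : toAmalgam M X hst hM (inclusion M hcX g) =
      Monoid.PushoutI.base (coreMap M X s t) g := by
    rw [← Monoid.PushoutI.of_apply_eq_base _ true, ← toAmalgam_inclusion_side M X hst hM]
    congr 1
    exact incl_injective M X (by simp [coreMap, incl_inclusion])
  rw [hbase, map_list_prod, List.map_map] at hg'
  have hw : Monoid.PushoutI.ofCoprodI (φ := coreMap M X s t) w.prod =
      Monoid.PushoutI.base (coreMap M X s t) g := by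
    rw [hg', Monoid.CoprodI.Word.prod, map_list_prod, List.map_map]
    congr 1
    refine List.map_congr_left fun p _ => ?_
    rw [Function.comp, Function.comp, Monoid.PushoutI.ofCoprodI_of, toAmalgam_inclusion_side]
  have hempty := Monoid.PushoutI.Reduced.eq_empty_of_mem_range (w := w)
    (fun b => inclusion_injective M _) hK ⟨g, hw.symm⟩
  apply hne
  have : K = [] := congrArg Monoid.CoprodI.Word.toList hempty
  rw [this, List.map_nil]

end Amalgam

end VirtualArtinGroup

namespace Computable

variable {α β γ σ : Type*} [Primcodable α] [Primcodable β] [Primcodable γ] [Primcodable σ]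

theorem of_finite [Finite α] (f : α → σ) : Computable f := (Primrec.dom_finite f).to_comp

theorem list_foldr {f : β → σ → σ} (hf : Computable₂ f) (b : σ) :
    Computable fun l : List β => l.foldr f b := by
  let step : List β → ℕ × σ → σ := fun l p =>
    Option.casesOn (l.reverse[p.1]?) p.2 fun a => f a p.2
  have hstep : Computable₂ step := by
    refine Computable.option_casesOn (o := fun q : List β × ℕ × σ => q.1.reverse[q.2.1]?)
      (f := fun q => q.2.2) (g := fun q a => f a q.2.2) ?_ (snd.comp snd) ?_
    · exact list_getElem?.comp (list_reverse.comp fst) (fst.comp snd)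
    · exact hf.comp snd (snd.comp (snd.comp fst))
  refine (nat_rec (f := List.length) (g := fun _ => b) list_length (const b) hstep).of_eq
    fun l => ?_
  have key : ∀ n, Nat.rec (motive := fun _ => σ) b (fun y IH => step l (y, IH)) n =
      (l.reverse.take n).foldl (fun s a => f a s) b := by
    intro n
    induction n with
    | zero => rfl
    | succ n ih =>
      simp only [ih, List.take_add_one, List.foldl_append, step]
      cases l.reverse[n]? <;> rfl
  rw [key, List.take_of_length_le (by simp), List.foldl_reverse]

theorem list_casesOn {f : α → List β} {g : α → σ} {h : α → β × List β → σ} (hf : Computable f)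
    (hg : Computable g) (hh : Computable₂ h) :
    @Computable _ σ _ _ fun a => List.casesOn (f a) (g a) fun b l => h a (b, l) := by
  have := option_casesOn (Primrec.list_head?.to_comp.comp hf) hg
    (g := fun a b => h a (b, (f a).tail))
    (hh.comp fst (Computable.pair snd (Primrec.list_tail.to_comp.comp (hf.comp fst))))
  refine this.of_eq fun a => ?_
  cases f a <;> rfl

theorem list_map {f : β → σ} (hf : Computable f) : Computable fun l : List β => l.map f := by
  refine (list_foldr (f := fun b l => f b :: l) (list_cons.comp (hf.comp fst) snd) []).of_eq
    fun l => ?_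
  induction l <;> simp_all

theorem list_filterMap {f : β → Option σ} (hf : Computable f) :
    Computable fun l : List β => l.filterMap f := by
  have h : Computable₂ fun (b : β) (l : List σ) =>
      (Option.casesOn (f b) l fun a => a :: l : List σ) :=
    option_casesOn (o := fun q : β × List σ => f q.1) (f := Prod.snd)
      (g := fun q a => a :: q.2) (hf.comp fst) snd (list_cons.comp snd (snd.comp fst))
  refine (list_foldr h []).of_eq fun l => ?_
  induction l with
  | nil => rfl
  | cons a l ih =>
    rw [List.foldr_cons, ih, List.filterMap_cons]
    cases f a <;> rfl

theorem bool_uncurry {f : Bool → α → σ} (hf : ∀ b, Computable (f b)) : Computable₂ f := by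
  refine (cond fst ((hf true).comp snd) ((hf false).comp snd)).of_eq ?_
  rintro ⟨_ | _, a⟩ <;> rfl

theorem list_find? {p : α → β → Bool} (hp : ∀ b, Computable fun a => p a b) (l : List β) :
    Computable fun a => l.find? (p a) := by
  induction l with
  | nil => exact const none
  | cons b l ih =>
    refine (cond (hp b) (const (some b)) ih).of_eq fun a => ?_
    cases h : p a b <;> simp [h]

end Computable

namespace VirtualArtinGroup

section ReducedForm

variable {A : Type*}

/-- Left multiplication of a reduced form by an element of the amalgamated part. -/
def absorb (r : List A) (L : List (Bool × List A)) (w : List A) :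
    List (Bool × List A) × List A :=
  match L with
  | [] => ([], r ++ w)
  | q :: L => ((q.1, r ++ q.2) :: L, w)

variable (mem : Bool → List A → Bool) (ret : Bool → List A → List A)

/-- Left multiplication of a reduced form by an element of a factor different from the factor of
the first syllable. -/
def pushSyllable (b : Bool) (v : List A) (L : List (Bool × List A))
    (w : List A) : List (Bool × List A) × List A :=
  bif mem b v then absorb (ret b v) L w else ((b, v) :: L, w)

variable (fac : A → Bool)

/-- Left multiplication of a reduced form by a letter. -/
def pushLetter (p : A) (st : List (Bool × List A) × List A) :
    List (Bool × List A) × List A :=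
  match st.1 with
  | [] => pushSyllable mem ret (fac p) [p] [] st.2
  | q :: L =>
    bif q.1 == fac p then pushSyllable mem ret (fac p) (p :: q.2) L st.2
    else pushSyllable mem ret (fac p) [p] (q :: L) st.2

/-- The reduced form of a word. -/
def reducedForm (w : List A) : List (Bool × List A) × List A :=
  w.foldr (pushLetter mem ret fac) ([], [])

section Computability

open Computable

variable {mem ret fac} [Primcodable A]

theorem computable_absorb : Computable fun q : List A × List (Bool × List A) × List A =>
    absorb q.1 q.2.1 q.2.2 := by
  have hnil : Computable fun q : List A × List (Bool × List A) × List A =>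
      (([] : List (Bool × List A)), q.1 ++ q.2.2) :=
    (const []).pair (list_append.comp fst (snd.comp snd))
  have hcons : Computable₂ fun (q : List A × List (Bool × List A) × List A)
      (r : (Bool × List A) × List (Bool × List A)) => ((r.1.1, q.1 ++ r.1.2) :: r.2, q.2.2) :=
    (list_cons.comp ((fst.comp (fst.comp snd)).pair
      (list_append.comp (fst.comp fst) (snd.comp (fst.comp snd)))) (snd.comp snd)).pair
      (snd.comp (snd.comp fst))
  refine (list_casesOn (fst.comp snd) hnil hcons).of_eq fun q => ?_
  rcases q with ⟨r, _ | _, w⟩ <;> rfl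

theorem computable_pushSyllable (hmem : Computable₂ mem) (hret : Computable₂ ret) :
    Computable fun q : (Bool × List A) × List (Bool × List A) × List A =>
      pushSyllable mem ret q.1.1 q.1.2 q.2.1 q.2.2 := by
  have hm : Computable fun q : (Bool × List A) × List (Bool × List A) × List A =>
      mem q.1.1 q.1.2 := hmem.comp (fst.comp fst) (snd.comp fst)
  have hr : Computable fun q : (Bool × List A) × List (Bool × List A) × List A =>
      ret q.1.1 q.1.2 := hret.comp (fst.comp fst) (snd.comp fst)
  have hc : Computable fun q : (Bool × List A) × List (Bool × List A) × List A =>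
      (q.1 :: q.2.1, q.2.2) := (list_cons.comp fst (fst.comp snd)).pair (snd.comp snd)
  have ha := computable_absorb.comp (hr.pair snd)
  exact (cond hm ha hc).of_eq fun q => rfl

theorem computable_pushLetter (hmem : Computable₂ mem) (hret : Computable₂ ret)
    (hfac : Computable fac) : Computable₂ (pushLetter mem ret fac) := by
  have hpush := computable_pushSyllable hmem hret
  have hnil : Computable fun q : A × List (Bool × List A) × List A =>
      ((fac q.1, [q.1]), ([] : List (Bool × List A)), q.2.2) :=
    ((hfac.comp fst).pair (list_cons.comp fst (const []))).pair ((const []).pair (snd.comp snd))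
  have hbeq : Computable₂ fun b c : Bool => b == c := of_finite _
  have htest : Computable fun x : (A × List (Bool × List A) × List A) ×
      (Bool × List A) × List (Bool × List A) => x.2.1.1 == fac x.1.1 :=
    hbeq.comp (fst.comp (fst.comp snd)) (hfac.comp (fst.comp fst))
  have hsame : Computable fun x : (A × List (Bool × List A) × List A) ×
      (Bool × List A) × List (Bool × List A) =>
      ((fac x.1.1, x.1.1 :: x.2.1.2), x.2.2, x.1.2.2) :=
    ((hfac.comp (fst.comp fst)).pair
      (list_cons.comp (fst.comp fst) (snd.comp (fst.comp snd)))).pair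
      ((snd.comp snd).pair (snd.comp (snd.comp fst)))
  have hdiff : Computable fun x : (A × List (Bool × List A) × List A) ×
      (Bool × List A) × List (Bool × List A) =>
      ((fac x.1.1, [x.1.1]), x.2.1 :: x.2.2, x.1.2.2) :=
    ((hfac.comp (fst.comp fst)).pair (list_cons.comp (fst.comp fst) (const []))).pair
      ((list_cons.comp (fst.comp snd) (snd.comp snd)).pair (snd.comp (snd.comp fst)))
  have hnil' := hpush.comp hnil
  have hcons : Computable₂ fun (q : A × List (Bool × List A) × List A)
      (r : (Bool × List A) × List (Bool × List A)) => bif r.1.1 == fac q.1 then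
        pushSyllable mem ret (fac q.1) (q.1 :: r.1.2) r.2 q.2.2
      else pushSyllable mem ret (fac q.1) [q.1] (r.1 :: r.2) q.2.2 := by
    have h := cond htest (hpush.comp hsame) (hpush.comp hdiff)
    exact h.of_eq fun x => rfl
  have hlist : Computable fun q : A × List (Bool × List A) × List A => q.2.1 := fst.comp snd
  have := list_casesOn hlist hnil' hcons
  refine this.of_eq ?_
  rintro ⟨p, _ | _, w⟩ <;> rfl

theorem computable_reducedForm (hmem : Computable₂ mem) (hret : Computable₂ ret)
    (hfac : Computable fac) : Computable (reducedForm mem ret fac) :=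
  list_foldr (computable_pushLetter hmem hret hfac) ([], [])

end Computability

end ReducedForm

section Algorithm

variable {S : Type*}

/-- Letters of words over the standard generators and their inverses. -/
abbrev Letter (S : Type*) : Type _ := (S ⊕ S) × Bool

/-- The vertex of a letter. -/
def Letter.index (p : Letter S) : S := Sum.elim id id p.1

/-- The letter of the same kind at another vertex. -/
def Letter.moveTo (p : Letter S) (y : S) : Letter S := (p.1.map (fun _ => y) (fun _ => y), p.2)

/-- The word `τ_{s₁} τ_{s₂} ⋯`. -/
def tauWord (l : List S) : List (Letter S) := l.map fun s => (Sum.inr s, true)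

/-- The formal inverse of a word. -/
def invWord (w : List (Letter S)) : List (Letter S) := (w.map fun p => (p.1, !p.2)).reverse

/-- The search for `y` in the list `ys` with `s z = z y` in the Coxeter group, where `z` is the
product of the list `zs` and `d` is a test for the triviality of words. -/
def labelSearch (d : List (Letter S) → Bool) (ys zs : List S) (s : S) : Option S :=
  ys.find? fun y => d (tauWord (s :: (zs ++ y :: zs.reverse)))

/-- One step of the computation of the retraction of a word. -/
def retractStep (d : List (Letter S) → Bool) (ys : List S) (p : Letter S)
    (st : List S × List (Letter S)) : List S × List (Letter S) :=
  match labelSearch d ys st.1 p.index with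
  | none => (p.index :: st.1, st.2)
  | some y => (st.1, p.moveTo y :: st.2)

/-- The computation of the retraction of a word on the subgraph spanned by the list `ys`. -/
def retractWord (d : List (Letter S) → Bool) (ys : List S) (w : List (Letter S)) :
    List (Letter S) :=
  (w.foldr (retractStep d ys) ([], [])).2

/-- The membership test for the subgroup spanned by the list `ys`. -/
def memTest (d : List (Letter S) → Bool) (ys : List S) (w : List (Letter S)) : Bool :=
  d (w ++ invWord (retractWord d ys w))

section Computability

open Computable

variable [Fintype S] [DecidableEq S]

theorem computable_tauWord : Computable (tauWord (S := S)) := list_map (of_finite _)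

theorem computable_invWord : Computable (invWord (S := S)) :=
  list_reverse.comp (list_map (of_finite _))

theorem computable_labelSearch {d : List (Letter S) → Bool} (hd : Computable d) (ys : List S) :
    Computable₂ fun zs s => labelSearch d ys zs s := by
  refine list_find? (α := List S × S)
    (p := fun q y => d (tauWord (q.2 :: (q.1 ++ y :: q.1.reverse)))) (fun y => ?_) ys
  exact hd.comp (computable_tauWord.comp (list_cons.comp snd (list_append.comp fst
    (list_cons.comp (const y) (list_reverse.comp fst)))))

theorem computable_retractStep {d : List (Letter S) → Bool} (hd : Computable d) (ys : List S) :
    Computable₂ (retractStep d ys) := by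
  have hidx : Computable fun q : Letter S × List S × List (Letter S) => q.1.index :=
    (of_finite Letter.index).comp fst
  have hrel : Computable₂ (Letter.moveTo (S := S)) := of_finite _
  have hsearch : Computable fun q : Letter S × List S × List (Letter S) =>
      labelSearch d ys q.2.1 q.1.index :=
    (computable_labelSearch hd ys).comp (fst.comp snd) hidx
  have hnone : Computable fun q : Letter S × List S × List (Letter S) =>
      (q.1.index :: q.2.1, q.2.2) :=
    (list_cons.comp hidx (fst.comp snd)).pair (snd.comp snd)
  have hlabel : Computable fun x : (Letter S × List S × List (Letter S)) × S =>
      x.1.1.moveTo x.2 := hrel.comp (fst.comp fst) snd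
  have hsome : Computable₂ fun (q : Letter S × List S × List (Letter S)) (y : S) =>
      (q.2.1, q.1.moveTo y :: q.2.2) :=
    (fst.comp (snd.comp fst)).pair (list_cons.comp hlabel (snd.comp (snd.comp fst)))
  have := option_casesOn hsearch hnone hsome
  refine this.of_eq fun q => ?_
  simp only [retractStep]
  cases labelSearch d ys q.2.1 q.1.index <;> rfl

theorem computable_retractWord {d : List (Letter S) → Bool} (hd : Computable d) (ys : List S) :
    Computable (retractWord d ys) :=
  snd.comp (list_foldr (computable_retractStep hd ys) ([], []))

theorem computable_memTest {d : List (Letter S) → Bool} (hd : Computable d) (ys : List S) :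
    Computable (memTest d ys) :=
  hd.comp (list_append.comp Computable.id (computable_invWord.comp (computable_retractWord hd ys)))

end Computability

end Algorithm

end VirtualArtinGroup

theorem altProd_mul_inv_altProd {H : Type*} [Group H] {a b : H} (ha : a * a = 1) (hb : b * b = 1)
    (n : ℕ) : altProd a b n * (altProd b a n)⁻¹ = (a * b) ^ n := by
  induction n generalizing a b with
  | zero => simp [altProd]
  | succ n ih =>
    rw [altProd_succ', altProd_succ', mul_inv_rev, inv_eq_of_mul_eq_one_left hb, ← mul_assoc,
      mul_assoc a, ih hb ha, pow_succ', mul_assoc, mul_assoc]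
    congr 1
    rw [← mul_pow_mul]

theorem altProd_eq_altProd_iff {H : Type*} [Group H] {a b : H} (ha : a * a = 1) (hb : b * b = 1)
    (n : ℕ) : altProd a b n = altProd b a n ↔ (a * b) ^ n = 1 := by
  rw [← altProd_mul_inv_altProd ha hb, mul_inv_eq_one]

namespace VirtualArtinGroup

section WordEvaluation

variable {S : Type*} (M : CoxeterMatrix S)

/-- The element of the virtual Artin group represented by a word. -/
def eval (w : List (Letter S)) : VirtualArtinGroup M := evalWord (Sum.elim (sigma M) (tau M)) w

@[simp]
theorem eval_nil : eval M [] = 1 := rfl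

theorem eval_append (v w : List (Letter S)) : eval M (v ++ w) = eval M v * eval M w := by
  simp [eval, evalWord]

theorem eval_cons (p : Letter S) (w : List (Letter S)) :
    eval M (p :: w) = eval M [p] * eval M w := eval_append M [p] w

theorem eval_singleton (p : Letter S) : eval M [p] =
    if p.2 then Sum.elim (sigma M) (tau M) p.1 else (Sum.elim (sigma M) (tau M) p.1)⁻¹ := by
  simp [eval, evalWord]

theorem eval_invWord (w : List (Letter S)) : eval M (invWord w) = (eval M w)⁻¹ := by
  induction w with
  | nil => simp [invWord]
  | cons p w ih =>
    rw [invWord, List.map_cons, List.reverse_cons, ← invWord, eval_append, ih, eval_cons M p w,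
      mul_inv_rev, eval_singleton, eval_singleton]
    rcases p with ⟨x, _ | _⟩ <;> simp

/-- The words all of whose letters are indexed by elements of `X`. -/
def IsWordOver (X : Set S) (w : List (Letter S)) : Prop := ∀ p ∈ w, p.index ∈ X

theorem IsWordOver.mono {X Y : Set S} (h : X ⊆ Y) {w : List (Letter S)} (hw : IsWordOver X w) :
    IsWordOver Y w := fun p hp => h (hw p hp)

theorem IsWordOver.append {X : Set S} {v w : List (Letter S)} (hv : IsWordOver X v)
    (hw : IsWordOver X w) : IsWordOver X (v ++ w) := fun p hp =>
  (List.mem_append.mp hp).elim (hv p) (hw p)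

theorem IsWordOver.cons {X : Set S} {p : Letter S} {w : List (Letter S)} (hp : p.index ∈ X)
    (hw : IsWordOver X w) : IsWordOver X (p :: w) :=
  List.forall_mem_cons.mpr ⟨hp, hw⟩

theorem isWordOver_nil (X : Set S) : IsWordOver X [] := by simp [IsWordOver]

theorem IsWordOver.invWord {X : Set S} {w : List (Letter S)} (hw : IsWordOver X w) :
    IsWordOver X (invWord w) := by
  intro p hp
  obtain ⟨q, hq, rfl⟩ := List.mem_map.mp (List.mem_reverse.mp hp)
  exact hw q hq

theorem isWordOver_tauWord {X : Set S} {l : List S} (hl : ∀ s ∈ l, s ∈ X) :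
    IsWordOver X (tauWord l) := by
  intro p hp
  obtain ⟨s, hs, rfl⟩ := List.mem_map.mp hp
  exact hl s hs

variable {M} in
theorem IsWordOver.eval_mem {X : Set S} {w : List (Letter S)} (hw : IsWordOver X w) :
    eval M w ∈ (incl M X).range := by
  induction w with
  | nil => exact one_mem _
  | cons p w ih =>
    rw [eval_cons]
    refine mul_mem ?_ (ih fun q hq => hw q (List.mem_cons_of_mem p hq))
    have hp := hw p List.mem_cons_self
    have h : ∀ c, gen M c p.index ∈ (incl M X).range := fun c =>
      ⟨gen _ c ⟨p.index, hp⟩, incl_gen M X c _⟩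
    rw [eval_singleton]
    rcases p with ⟨x | x, _ | _⟩
    exacts [inv_mem (h true), h true, inv_mem (h false), h false]

end WordEvaluation

section CoxeterGroup

variable {S : Type*} (M : CoxeterMatrix S)

theorem isRep_simple : IsVirtualArtinRep M fun _ s => M.toCoxeterSystem.simple s := by
  have braid : ∀ s t, altProd (M.toCoxeterSystem.simple s) (M.toCoxeterSystem.simple t) (M s t) =
      altProd (M.toCoxeterSystem.simple t) (M.toCoxeterSystem.simple s) (M s t) := fun s t =>
    (altProd_eq_altProd_iff (M.toCoxeterSystem.simple_mul_simple_self s)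
      (M.toCoxeterSystem.simple_mul_simple_self t) _).mpr
      (M.toCoxeterSystem.simple_mul_simple_pow s t)
  refine ⟨fun _ s t _ _ => braid s t,
    fun s => M.toCoxeterSystem.simple_mul_simple_self s, fun s t hst hM => ?_⟩
  obtain ⟨m, hm⟩ := Nat.exists_eq_succ_of_ne_zero hM
  have h := braid s t
  rw [hm, Nat.succ_eq_add_one, altProd_succ', altProd_succ] at h
  simp only [hm, Nat.succ_eq_add_one, Nat.add_sub_cancel, Nat.even_add_one, h]
  split <;> simp_all

theorem isLiftable_tau : M.IsLiftable (tau M) := by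
  intro s t
  by_cases hM : M s t = 0
  · simp [hM]
  have hsq : ∀ s, tau M s * tau M s = 1 := (isRep_gen M).sq
  by_cases hst : s = t
  · subst hst
    rw [hsq, one_pow]
  · exact (altProd_eq_altProd_iff (hsq s) (hsq t) _).mp ((isRep_gen M).braid false s t hst hM)

theorem eval_tauWord (l : List S) : eval M (tauWord l) =
    M.toCoxeterSystem.lift ⟨tau M, isLiftable_tau M⟩ (M.toCoxeterSystem.wordProd l) := by
  induction l with
  | nil => simp [tauWord]
  | cons s l ih =>
    rw [tauWord, List.map_cons, eval_cons, ← tauWord, ih, CoxeterSystem.wordProd_cons, map_mul,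
      CoxeterSystem.lift_apply_simple, eval_singleton]
    rfl

theorem eval_tauWord_eq_one_iff (l : List S) :
    eval M (tauWord l) = 1 ↔ M.toCoxeterSystem.wordProd l = 1 := by
  rw [eval_tauWord]
  refine ⟨fun h => ?_, fun h => by rw [h, map_one]⟩
  have key : ((lift (isRep_simple M)).comp
      (M.toCoxeterSystem.lift ⟨tau M, isLiftable_tau M⟩)) = MonoidHom.id _ := by
    refine M.toCoxeterSystem.ext_simple fun s => ?_
    rw [MonoidHom.comp_apply, CoxeterSystem.lift_apply_simple]
    exact lift_gen (isRep_simple M) false s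
  have := DFunLike.congr_fun key (M.toCoxeterSystem.wordProd l)
  rw [MonoidHom.comp_apply, h, map_one] at this
  exact this.symm

end CoxeterGroup

section Retraction

variable {S : Type*} (M : CoxeterMatrix S)

/-- The function `d` decides whether words over `X` represent the identity. -/
def Decides (X : Set S) (d : List (Letter S) → Bool) : Prop :=
  ∀ w, IsWordOver X w → (d w = true ↔ eval M w = 1)

theorem cosetAction_eval_singleton (J : Set S) (p : Letter S) :
    ∃ κ : J → VirtualArtinGroup (M.restrict J),
      (∀ j, incl M J (κ j) = eval M [p.moveTo j]) ∧
      ∀ q, (cosetAction M J (eval M [p]) q).1 = M.toCoxeterSystem.step κ p.index q.1 := by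
  have hpos : ∀ c s q, (cosetAction M J (gen M c s) q).1 =
      M.toCoxeterSystem.step (gen (M.restrict J) c) s q.1 := fun c s q => by
    rw [cosetAction, lift_gen]; rfl
  have hneg : ∀ c s q, (cosetAction M J (gen M c s)⁻¹ q).1 =
      M.toCoxeterSystem.step (gen (M.restrict J) c)⁻¹ s q.1 := fun c s q => by
    rw [map_inv, cosetAction, lift_gen]; rfl
  have hincl : ∀ c j, incl M J (gen _ c j) = gen M c j := incl_gen M J
  simp only [eval_singleton]
  rcases p with ⟨s | s, _ | _⟩
  · exact ⟨(gen _ true)⁻¹, fun j => (map_inv _ _).trans (congrArg _ (hincl true j)),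
      fun q => hneg true s q⟩
  · exact ⟨gen _ true, hincl true, fun q => hpos true s q⟩
  · exact ⟨(gen _ false)⁻¹, fun j => (map_inv _ _).trans (congrArg _ (hincl false j)),
      fun q => hneg false s q⟩
  · exact ⟨gen _ false, hincl false, fun q => hpos false s q⟩

variable {M} {X Y : Set S} {d : List (Letter S) → Bool} {ys : List S}

theorem Decides.labelSearch_test_iff (hd : Decides M X d) {zs : List S} (hzs : ∀ z ∈ zs, z ∈ X)
    {s y : S} (hs : s ∈ X) (hy : y ∈ X) :
    d (tauWord (s :: (zs ++ y :: zs.reverse))) = true ↔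
      M.toCoxeterSystem.simple s * M.toCoxeterSystem.wordProd zs =
        M.toCoxeterSystem.wordProd zs * M.toCoxeterSystem.simple y := by
  rw [hd _ (isWordOver_tauWord ?_), eval_tauWord_eq_one_iff, CoxeterSystem.wordProd_cons,
    CoxeterSystem.wordProd_append, CoxeterSystem.wordProd_cons, CoxeterSystem.wordProd_reverse,
    ← mul_assoc, ← mul_assoc, mul_inv_eq_one, ← eq_mul_inv_iff_mul_eq, CoxeterSystem.inv_simple]
  simp only [List.mem_cons, List.mem_append, List.mem_reverse]
  rintro x (rfl | h | rfl | h)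
  exacts [hs, hzs x h, hy, hzs x h]

theorem Decides.foldr_retractStep (hd : Decides M X d) (hys : ∀ y, y ∈ ys ↔ y ∈ Y) (hYX : Y ⊆ X)
    {w : List (Letter S)} (hw : IsWordOver X w) :
    (∀ z ∈ (w.foldr (retractStep d ys) ([], [])).1, z ∈ X) ∧
    IsWordOver Y (w.foldr (retractStep d ys) ([], [])).2 ∧
    (cosetAction M Y (eval M w) (basePoint M Y 1)).1.1 =
      M.toCoxeterSystem.wordProd (w.foldr (retractStep d ys) ([], [])).1 ∧
    incl M Y (cosetAction M Y (eval M w) (basePoint M Y 1)).1.2 =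
      eval M (w.foldr (retractStep d ys) ([], [])).2 := by
  induction w with
  | nil => simp [basePoint, isWordOver_nil]
  | cons p w ih =>
    obtain ⟨h1, h2, h3, h4⟩ := ih fun q hq => hw q (List.mem_cons_of_mem p hq)
    have hp : p.index ∈ X := hw p List.mem_cons_self
    obtain ⟨κ, hκ, hstep⟩ := cosetAction_eval_singleton M Y p
    rw [eval_cons, map_mul, Equiv.Perm.mul_apply, hstep, List.foldr_cons]
    generalize (cosetAction M Y (eval M w) (basePoint M Y 1)) = q at h3 h4 ⊢
    generalize w.foldr (retractStep d ys) ([], []) = st at h1 h2 h3 h4 ⊢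
    obtain ⟨⟨z, g⟩, hq⟩ := q
    obtain ⟨zs, out⟩ := st
    dsimp only at h1 h2 h3 h4 ⊢
    subst h3
    rw [retractStep]
    cases hlab : labelSearch d ys zs p.index with
    | none =>
      rw [CoxeterSystem.step_of_ne]
      · exact ⟨List.forall_mem_cons.mpr ⟨hp, h1⟩, h2, (CoxeterSystem.wordProd_cons _ _ _).symm, h4⟩
      · intro j hj
        have := List.find?_eq_none.mp hlab j ((hys j).mpr j.2)
        exact this ((hd.labelSearch_test_iff h1 hp (hYX j.2)).mpr hj)
    | some y =>
      have hy : y ∈ Y := (hys y).mp (List.mem_of_find?_eq_some hlab)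
      have htest := (hd.labelSearch_test_iff h1 hp (hYX hy)).mp (List.find?_some
        (p := fun y => d (tauWord (p.index :: (zs ++ y :: zs.reverse)))) hlab)
      rw [CoxeterSystem.step_of_eq _ _ (j := ⟨y, hy⟩) htest]
      refine ⟨h1, h2.cons ?_, rfl, ?_⟩
      · rcases p with ⟨x | x, b⟩ <;> exact hy
      · rw [map_mul, hκ, h4]
        exact (eval_cons M (p.moveTo y) out).symm

theorem Decides.isWordOver_retractWord (hd : Decides M X d) (hys : ∀ y, y ∈ ys ↔ y ∈ Y)
    (hYX : Y ⊆ X) {w : List (Letter S)} (hw : IsWordOver X w) :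
    IsWordOver Y (retractWord d ys w) :=
  (hd.foldr_retractStep hys hYX hw).2.1

theorem Decides.eval_retractWord (hd : Decides M X d) (hys : ∀ y, y ∈ ys ↔ y ∈ Y)
    (hYX : Y ⊆ X) {w : List (Letter S)} (hw : IsWordOver X w) :
    eval M (retractWord d ys w) = incl M Y (retract M Y (eval M w)) :=
  (hd.foldr_retractStep hys hYX hw).2.2.2.symm

theorem Decides.memTest_iff (hd : Decides M X d) (hys : ∀ y, y ∈ ys ↔ y ∈ Y)
    (hYX : Y ⊆ X) {w : List (Letter S)} (hw : IsWordOver X w) :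
    memTest d ys w = true ↔ eval M w ∈ (incl M Y).range := by
  have h := hd.isWordOver_retractWord hys hYX hw
  rw [memTest, hd _ (hw.append (h.mono hYX).invWord), eval_append, eval_invWord, mul_inv_eq_one,
    hd.eval_retractWord hys hYX hw, mem_range_incl_iff, eq_comm]

end Retraction

section Amalgam

variable {S : Type*} (M : CoxeterMatrix S) (X : Set S) (s t : S)

/-- Reduced forms in the amalgamated product along a pair with `m_{s,t} = ∞`. -/
structure IsReducedForm (st : List (Bool × List (Letter S)) × List (Letter S)) : Prop where
  isChain : st.1.IsChain fun p q => p.1 ≠ q.1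
  isWordOver_side : ∀ p ∈ st.1, IsWordOver (side X s t p.1) p.2
  notMem_core : ∀ p ∈ st.1, eval M p.2 ∉ (incl M (core X s t)).range
  isWordOver_core : IsWordOver (core X s t) st.2

/-- The element represented by a reduced form. -/
def formEval (st : List (Bool × List (Letter S)) × List (Letter S)) : VirtualArtinGroup M :=
  (st.1.map fun p => eval M p.2).prod * eval M st.2

variable {M X s t}

theorem IsReducedForm.formEval_ne_one (hst : s ≠ t) (hM : M s t = 0)
    {st : List (Bool × List (Letter S)) × List (Letter S)} (h : IsReducedForm M X s t st)
    (hne : st.1 ≠ []) : formEval M st ≠ 1 := by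
  intro h1
  refine prod_notMem_range_incl_core M X hst hM (st.1.map fun p => (p.1, eval M p.2)) ?_ ?_ ?_
    (by simpa using hne) ?_
  · exact (List.isChain_map _).mpr h.isChain
  · intro x hx
    obtain ⟨p, hp, rfl⟩ := List.mem_map.mp hx
    exact (h.isWordOver_side p hp).eval_mem
  · intro x hx
    obtain ⟨p, hp, rfl⟩ := List.mem_map.mp hx
    exact h.notMem_core p hp
  · rw [List.map_map]
    have := eq_inv_of_mul_eq_one_left h1
    rw [show Prod.snd ∘ (fun p : Bool × List (Letter S) => (p.1, eval M p.2)) =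
      fun p => eval M p.2 from rfl, this]
    exact inv_mem h.isWordOver_core.eval_mem

theorem IsReducedForm.absorb {r : List (Letter S)} (hr : IsWordOver (core X s t) r)
    {st : List (Bool × List (Letter S)) × List (Letter S)} (h : IsReducedForm M X s t st) :
    IsReducedForm M X s t (absorb r st.1 st.2) ∧
      formEval M (absorb r st.1 st.2) = eval M r * formEval M st := by
  rcases st with ⟨_ | ⟨q, L⟩, w⟩
  · exact ⟨⟨.nil, by simp [VirtualArtinGroup.absorb], by simp [VirtualArtinGroup.absorb],
      hr.append h.isWordOver_core⟩, by simp [VirtualArtinGroup.absorb, formEval, eval_append]⟩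
  · have hside := List.forall_mem_cons.mp h.isWordOver_side
    have hcore := List.forall_mem_cons.mp h.notMem_core
    refine ⟨⟨?_, List.forall_mem_cons.mpr ⟨?_, hside.2⟩, List.forall_mem_cons.mpr ⟨?_, hcore.2⟩,
      h.isWordOver_core⟩, ?_⟩
    · exact List.isChain_cons.mpr (List.isChain_cons.mp h.isChain)
    · exact (hr.mono (core_subset_side X s t q.1)).append hside.1
    · rw [eval_append, Subgroup.mul_mem_cancel_left _ hr.eval_mem]
      exact hcore.1
    · simp [VirtualArtinGroup.absorb, formEval, eval_append, mul_assoc]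

variable {d : Bool → List (Letter S) → Bool} {ys : List S}

theorem IsReducedForm.pushSyllable (hd : ∀ b, Decides M (side X s t b) (d b))
    (hys : ∀ y, y ∈ ys ↔ y ∈ core X s t) {b : Bool} {v : List (Letter S)}
    (hv : IsWordOver (side X s t b) v)
    {st : List (Bool × List (Letter S)) × List (Letter S)} (h : IsReducedForm M X s t st)
    (hb : ∀ q ∈ st.1.head?, b ≠ q.1) :
    IsReducedForm M X s t (pushSyllable (fun b => memTest (d b) ys)
      (fun b => retractWord (d b) ys) b v st.1 st.2) ∧
    formEval M (pushSyllable (fun b => memTest (d b) ys)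
      (fun b => retractWord (d b) ys) b v st.1 st.2) = eval M v * formEval M st := by
  have hsub := core_subset_side X s t b
  have hmem := (hd b).memTest_iff hys hsub hv
  rw [VirtualArtinGroup.pushSyllable]
  cases hc : memTest (d b) ys v with
  | true =>
    have heval : eval M (retractWord (d b) ys v) = eval M v := by
      rw [(hd b).eval_retractWord hys hsub hv]
      exact (mem_range_incl_iff M _).mp (hmem.mp hc)
    rw [← heval]
    exact h.absorb ((hd b).isWordOver_retractWord hys hsub hv)
  | false =>
    have hv' : eval M v ∉ (incl M (core X s t)).range := fun h => by simp [hmem.mpr h] at hc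
    refine ⟨⟨List.isChain_cons.mpr ⟨hb, h.isChain⟩,
      List.forall_mem_cons.mpr ⟨hv, h.isWordOver_side⟩,
      List.forall_mem_cons.mpr ⟨hv', h.notMem_core⟩, h.isWordOver_core⟩, ?_⟩
    simp [formEval, mul_assoc]

theorem IsReducedForm.pushLetter (hd : ∀ b, Decides M (side X s t b) (d b))
    (hys : ∀ y, y ∈ ys ↔ y ∈ core X s t) {fac : Letter S → Bool} {p : Letter S}
    (hp : p.index ∈ side X s t (fac p))
    {st : List (Bool × List (Letter S)) × List (Letter S)} (h : IsReducedForm M X s t st) :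
    IsReducedForm M X s t (pushLetter (fun b => memTest (d b) ys)
      (fun b => retractWord (d b) ys) fac p st) ∧
    formEval M (pushLetter (fun b => memTest (d b) ys)
      (fun b => retractWord (d b) ys) fac p st) = eval M [p] * formEval M st := by
  have hp' : IsWordOver (side X s t (fac p)) [p] := (isWordOver_nil _).cons hp
  rcases st with ⟨_ | ⟨q, L⟩, w⟩
  · exact h.pushSyllable hd hys hp' (by simp)
  · have hchain := List.isChain_cons.mp h.isChain
    have hside := List.forall_mem_cons.mp h.isWordOver_side
    cases hc : q.1 == fac p with
    | true =>
      simp only [VirtualArtinGroup.pushLetter, hc, cond_true]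
      rw [beq_iff_eq] at hc
      have htail : IsReducedForm M X s t (L, w) := ⟨hchain.2, hside.2,
        (List.forall_mem_cons.mp h.notMem_core).2, h.isWordOver_core⟩
      have := htail.pushSyllable hd hys (b := fac p) (v := p :: q.2) ((hc ▸ hside.1).cons hp)
        (fun r hr => hc ▸ hchain.1 r hr)
      refine ⟨this.1, this.2.trans ?_⟩
      rw [eval_cons]
      simp [formEval, mul_assoc]
    | false =>
      simp only [VirtualArtinGroup.pushLetter, hc, cond_false]
      rw [beq_eq_false_iff_ne] at hc
      exact h.pushSyllable hd hys hp' (by simpa using hc.symm)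

theorem isReducedForm_reducedForm (hd : ∀ b, Decides M (side X s t b) (d b))
    (hys : ∀ y, y ∈ ys ↔ y ∈ core X s t) {fac : Letter S → Bool}
    (hfac : ∀ p : Letter S, p.index ∈ X → p.index ∈ side X s t (fac p))
    {w : List (Letter S)} (hw : IsWordOver X w) :
    IsReducedForm M X s t (reducedForm (fun b => memTest (d b) ys)
      (fun b => retractWord (d b) ys) fac w) ∧
    formEval M (reducedForm (fun b => memTest (d b) ys)
      (fun b => retractWord (d b) ys) fac w) = eval M w := by
  induction w with
  | nil => exact ⟨⟨.nil, by simp [reducedForm], by simp [reducedForm], isWordOver_nil _⟩,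
      by simp [reducedForm, formEval]⟩
  | cons p w ih =>
    obtain ⟨h1, h2⟩ := ih fun q hq => hw q (List.mem_cons_of_mem p hq)
    have := h1.pushLetter hd hys (hfac p (hw p List.mem_cons_self))
    rw [h2, ← eval_cons] at this
    exact this

end Amalgam

section WordProblem

variable {S : Type*} [Fintype S] [DecidableEq S] {M : CoxeterMatrix S}

/-- The word problem for words over `X` in the virtual Artin group. -/
def IsDecidableOver (M : CoxeterMatrix S) (X : Set S) : Prop :=
  ∃ d : List (Letter S) → Bool, Computable d ∧ Decides M X d

theorem isDecidableOver_of_solvableWordProblem {X : Set S} [Primcodable X]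
    (h : SolvableWordProblem (Sum.elim (sigma (M.restrict X)) (tau (M.restrict X)))) :
    IsDecidableOver M X := by
  classical
  obtain ⟨d, hd, hdX⟩ := ComputablePred.computable_iff.mp h
  let φ : Letter S → Option (Letter X) := fun p =>
    if h : p.index ∈ X then some (p.1.map (fun _ => ⟨_, h⟩) (fun _ => ⟨_, h⟩), p.2) else none
  refine ⟨fun w => d (w.filterMap φ),
    hd.comp (Computable.list_filterMap (Computable.of_finite φ)), fun w hw => ?_⟩
  have key : incl M X (eval (M.restrict X) (w.filterMap φ)) = eval M w := by
    induction w with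
    | nil => simp
    | cons p w ih =>
      have hp : p.index ∈ X := hw p List.mem_cons_self
      have hφ : φ p = some (p.1.map (fun _ => ⟨_, hp⟩) (fun _ => ⟨_, hp⟩), p.2) := dif_pos hp
      rw [List.filterMap_cons, hφ, eval_cons, map_mul,
        ih fun q hq => hw q (List.mem_cons_of_mem p hq), eval_cons M p, eval_singleton,
        eval_singleton]
      congr 1
      have hgen : ∀ c, incl M X (gen _ c ⟨p.index, hp⟩) = gen M c p.index :=
        fun c => incl_gen M X c _
      rcases p with ⟨x | x, _ | _⟩
      · exact (map_inv _ _).trans (congrArg _ (hgen true))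
      · exact hgen true
      · exact (map_inv _ _).trans (congrArg _ (hgen false))
      · exact hgen false
  rw [← key, map_eq_one_iff _ (incl_injective M X)]
  exact (iff_of_eq (congrFun hdX (w.filterMap φ))).symm

theorem isDecidableOver_of_side {X : Set S} {s t : S} (hst : s ≠ t) (hM : M s t = 0)
    (h : ∀ b, IsDecidableOver M (side X s t b)) : IsDecidableOver M X := by
  classical
  choose d hd hdX using h
  obtain ⟨ys, hys⟩ : ∃ ys : List S, ∀ y, y ∈ ys ↔ y ∈ core X s t :=
    ⟨(core X s t).toFinset.toList, fun y => by simp⟩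
  let fac : Letter S → Bool := fun p => decide (p.index ≠ s)
  have hfac : ∀ p : Letter S, p.index ∈ X → p.index ∈ side X s t (fac p) := by
    intro p hp
    refine ⟨hp, ?_⟩
    by_cases hps : p.index = s <;> simp [fac, hps, hst]
  let form := reducedForm (fun b => memTest (d b) ys) (fun b => retractWord (d b) ys) fac
  have hform : Computable form := computable_reducedForm
    (Computable.bool_uncurry fun b => computable_memTest (hd b) ys)
    (Computable.bool_uncurry fun b => computable_retractWord (hd b) ys) (Computable.of_finite _)
  refine ⟨fun w => List.casesOn (form w).1 (d true (form w).2) fun _ _ => false, ?_, fun w hw => ?_⟩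
  · exact Computable.list_casesOn (Computable.fst.comp hform)
      ((hd true).comp (Computable.snd.comp hform)) (Computable.const false).to₂
  · obtain ⟨h1, h2⟩ := isReducedForm_reducedForm hdX hys hfac hw
    rw [← h2]
    change IsReducedForm M X s t (form w) at h1
    change List.casesOn (form w).1 (d true (form w).2) (fun _ _ => false) = true ↔
      formEval M (form w) = 1
    generalize form w = st at h1 ⊢
    rcases st with ⟨_ | ⟨q, L⟩, c⟩
    · simpa [formEval] using hdX true c (h1.isWordOver_core.mono (core_subset_side X s t true))
    · simpa using h1.formEval_ne_one hst hM (by simp)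

end WordProblem

end VirtualArtinGroup

/-- **Theorem 1.4.** If the word problem in `VA[Γ_X]` is solvable for every free of infinity
subset `X ⊆ S`, then the word problem in `VA[Γ]` is solvable. -/
theorem va_word_problem_of_free_of_infinity {S : Type*} [Fintype S] [DecidableEq S]
    (M : CoxeterMatrix S)
    (h : ∀ X : Finset S, (∀ s ∈ X, ∀ t ∈ X, M s t ≠ 0) →
      SolvableWordProblem
        (Sum.elim (VirtualArtinGroup.sigma (M.restrict ↑X))
          (VirtualArtinGroup.tau (M.restrict ↑X)))) :
    SolvableWordProblem (Sum.elim (VirtualArtinGroup.sigma M) (VirtualArtinGroup.tau M)) := by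
  have key : ∀ X : Finset S, VirtualArtinGroup.IsDecidableOver M (X : Set S) := by
    intro X
    induction X using Finset.strongInduction with
    | H X ih =>
      by_cases hX : ∀ s ∈ X, ∀ t ∈ X, M s t ≠ 0
      · exact VirtualArtinGroup.isDecidableOver_of_solvableWordProblem (h X hX)
      · push Not at hX
        obtain ⟨s, hs, t, ht, hM⟩ := hX
        have hst : s ≠ t := by
          rintro rfl
          simp at hM
        refine VirtualArtinGroup.isDecidableOver_of_side hst hM fun b => ?_
        have hside :
            VirtualArtinGroup.side (X : Set S) s t b =
              (X.erase (if b then s else t) : Finset S) := by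
          ext x
          simp [VirtualArtinGroup.side, and_comm]
        rw [hside]
        exact ih _ (Finset.erase_ssubset (by cases b; exacts [ht, hs]))
  obtain ⟨d, hd, hdX⟩ := key Finset.univ
  refine ComputablePred.computable_iff.mpr ⟨d, hd, funext fun w => propext ?_⟩
  exact (hdX w fun p _ => by simp).symm
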